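/- arXiv:2211.06887 — 2 statements merged into one kernel-verified Lean document; each statement's English description precedes it below -/
import Mathlib

section
/- Let a matching market with transferable utilities be given. If the firm-worker hypergraph of the market has no nontrivial odd-length cycle, then a stable matching exists. -/
open Finset


/-- A cycle of length `k` in a hypergraph with edge predicate `edges`:
a cyclic alternating sequence of `k` distinct vertices `j 0, …, j (k-1)` and
`k` distinct edges `E 0, …, E (k-1)` with `j i ∈ E i` and `j (i+1) ∈ E i`
(indices modulo `k`), where `k ≥ 2`. -/
def IsCycle {V : Type*} (edges : Finset V → Prop) (k : ℕ)
    (j : ZMod k → V) (E : ZMod k → Finset V) : Prop :=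
  2 ≤ k ∧ Function.Injective j ∧ Function.Injective E ∧
    (∀ i, edges (E i)) ∧ (∀ i, j i ∈ E i ∧ j (i + 1) ∈ E i)

/-- A nontrivial odd-length cycle: a cycle of odd length such that every edge `E i`
of the cycle contains exactly two of the cycle's vertices; since `j i` and `j (i+1)`
are two distinct cycle vertices belonging to `E i`, this says that the only cycle
vertices in `E i` are `j i` and `j (i+1)`. -/
def IsNontrivialOddCycle {V : Type*} (edges : Finset V → Prop) (k : ℕ)
    (j : ZMod k → V) (E : ZMod k → Finset V) : Prop :=
  IsCycle edges k j E ∧ Odd k ∧ ∀ i t : ZMod k, j t ∈ E i → t = i ∨ t = i + 1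

/-- The hypergraph with edge predicate `edges` has some nontrivial odd-length cycle. -/
def HasNontrivialOddCycle {V : Type*} (edges : Finset V → Prop) : Prop :=
  ∃ (k : ℕ) (j : ZMod k → V) (E : ZMod k → Finset V),
    IsNontrivialOddCycle edges k j E

/-- The set of workers assigned to firm `f` by the assignment `μ`. -/
def assignedSet {F W : Type*} [Fintype W] [DecidableEq F] (μ : W → Option F) (f : F) :
    Finset W :=
  Finset.univ.filter fun w => μ w = some f

/-- A many-to-one matching market with transferable utilities: firms `F`, workers `W`,
for each firm `f` a collection `acc f` of (nonempty) acceptable sets of workers and a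
valuation `vF f` with `vF f ∅ = 0`, and for each worker `w` a set `accW w` of acceptable
firms and a valuation `vW w` (with `none` denoting being unmatched) with `vW w none = 0`. -/
structure TUMarket (F W : Type*) [Fintype W] [DecidableEq F] [DecidableEq W] where
  acc : F → Finset (Finset W)
  acc_nonempty : ∀ f, ∀ S ∈ acc f, S.Nonempty
  vF : F → Finset W → ℝ
  vF_empty : ∀ f, vF f ∅ = 0
  accW : W → Finset F
  vW : W → Option F → ℝ
  vW_none : ∀ w, vW w none = 0

namespace TUMarket

variable {F W : Type*} [Fintype W] [DecidableEq F] [DecidableEq W]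

/-- Firm `f`'s utility from hiring the set `S` at prices `p`. -/
def Uf (M : TUMarket F W) (f : F) (S : Finset W) (p : W → ℝ) : ℝ :=
  M.vF f S - ∑ w ∈ S, p w

/-- Worker `w`'s utility from being matched to `o` at prices `p`. -/
def Uw (M : TUMarket F W) (w : W) (o : Option F) (p : W → ℝ) : ℝ :=
  M.vW w o + p w

/-- `(μ, p)` is a matching: unmatched workers have price `0`. -/
def IsMatching (_M : TUMarket F W) (μ : W → Option F) (p : W → ℝ) : Prop :=
  ∀ w, μ w = none → p w = 0

/-- Individual rationality of the matching `(μ, p)`. -/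
def IndivRat (M : TUMarket F W) (μ : W → Option F) (p : W → ℝ) : Prop :=
  (∀ w, (∀ f, μ w = some f → f ∈ M.accW w) ∧ 0 ≤ M.Uw w (μ w) p) ∧
  (∀ f, (assignedSet μ f = ∅ ∨ assignedSet μ f ∈ M.acc f) ∧
    0 ≤ M.Uf f (assignedSet μ f) p)

/-- `(f, S, p')` blocks the matching `(μ, p)`: `S` is acceptable to `f`, `f` is acceptable
to every `w ∈ S`, all members of `{f} ∪ S` are weakly better off, and at least one is
strictly better off. -/
def Blocks (M : TUMarket F W) (μ : W → Option F) (p : W → ℝ)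
    (f : F) (S : Finset W) (p' : W → ℝ) : Prop :=
  S ∈ M.acc f ∧ (∀ w ∈ S, f ∈ M.accW w) ∧
    M.Uf f (assignedSet μ f) p ≤ M.Uf f S p' ∧
    (∀ w ∈ S, M.Uw w (μ w) p ≤ M.Uw w (some f) p') ∧
    (M.Uf f (assignedSet μ f) p < M.Uf f S p' ∨
      ∃ w ∈ S, M.Uw w (μ w) p < M.Uw w (some f) p')

/-- Stability of a matching `(μ, p)` in a market with transferable utilities. -/
def Stable (M : TUMarket F W) (μ : W → Option F) (p : W → ℝ) : Prop :=
  M.IsMatching μ p ∧ M.IndivRat μ p ∧ ¬ ∃ f S p', M.Blocks μ p f S p'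

/-- The firm-worker hypergraph of the market: vertices `F ⊕ W`, and an edge
`{f} ∪ S` for each firm `f` and each acceptable set `S ∈ acc f`. -/
def fwEdges (M : TUMarket F W) (e : Finset (F ⊕ W)) : Prop :=
  ∃ f S, S ∈ M.acc f ∧ e = insert (Sum.inl f) (S.image Sum.inr)

end TUMarket

/-- No strong odd cycle: there are no cyclic families `a`, `b` of odd length at least three
such that `a i` is incident to `b t` exactly when `i = t` or `i = t + 1`. -/
def StrongOddCycleFree {A B : Type*} (R : A → B → Prop) : Prop :=
  ∀ (k : ℕ) (a : ZMod k → A) (b : ZMod k → B), 3 ≤ k → Odd k →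
    ¬ ∀ i t, R (a i) (b t) ↔ i = t ∨ i = t + 1

/-- `x` and `y` are the only two members of `X` incident to some `b`. -/
def LinkedIn {A B : Type*} (R : A → B → Prop) (X : Finset A) (x y : A) : Prop :=
  x ≠ y ∧ x ∈ X ∧ y ∈ X ∧ ∃ b, ∀ a ∈ X, R a b ↔ a = x ∨ a = y

/-- `q 0, …, q n` is a path of pairwise distinct linked members of `X`. -/
def IsLinkedPath {A B : Type*} (R : A → B → Prop) (X : Finset A) (n : ℕ) (q : ℕ → A) : Prop :=
  (∀ s ≤ n, q s ∈ X) ∧ (∀ s ≤ n, ∀ t ≤ n, q s = q t → s = t) ∧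
    ∀ s < n, LinkedIn R X (q s) (q (s + 1))

/-- The end of a longest path is linked only to members of that path. -/
theorem exists_maximal_isLinkedPath {A B : Type*} (R : A → B → Prop) {X : Finset A}
    (hX : X.Nonempty) :
    ∃ n q, IsLinkedPath R X n q ∧ ∀ y, LinkedIn R X (q 0) y → ∃ s ≤ n, y = q s := by
  classical
  have hbound : ∀ n q, IsLinkedPath R X n q → n ≤ X.card := by
    rintro n q ⟨h1, h2, -⟩
    have hle : (Finset.range n).card ≤ X.card := by
      refine Finset.card_le_card_of_injOn q (fun s hs => h1 s ?_) (fun s hs t ht => h2 s ?_ t ?_)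
      all_goals simp at *; omega
    simpa using hle
  obtain ⟨x, hx⟩ := hX
  have h0 : ∃ q, IsLinkedPath R X 0 q :=
    ⟨fun _ => x, fun _ _ => hx, fun s hs t ht _ => by omega, fun s hs => by omega⟩
  obtain ⟨q, hq⟩ := Nat.findGreatest_spec (P := fun n => ∃ q, IsLinkedPath R X n q)
    (Nat.zero_le X.card) h0
  refine ⟨_, q, hq, fun y hy => ?_⟩
  generalize hn : Nat.findGreatest (fun n => ∃ q, IsLinkedPath R X n q) X.card = n at hq ⊢
  by_contra! hc
  obtain ⟨h1, h2, h3⟩ := hq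
  have hext : IsLinkedPath R X (n + 1) (fun s => if s = 0 then y else q (s - 1)) := by
    refine ⟨fun s hs => ?_, fun s hs t ht => ?_, fun s hs => ?_⟩
    · dsimp only
      split_ifs
      · exact hy.2.2.1
      · exact h1 _ (by omega)
    · dsimp only
      split_ifs
      · omega
      · intro h; exact absurd h (hc _ (by omega))
      · intro h; exact absurd h.symm (hc _ (by omega))
      · intro h; have := h2 _ (by omega) _ (by omega) h; omega
    · rcases s with _ | s
      · obtain ⟨hne, hx, hy, b, hb⟩ := hy
        exact ⟨hne.symm, hy, hx, b, fun a ha => (hb a ha).trans or_comm⟩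
      · simpa using h3 s (by omega)
  have := Nat.le_findGreatest (P := fun n => ∃ q, IsLinkedPath R X n q)
    (hbound _ _ hext) ⟨_, hext⟩
  omega

/-- In the absence of strong odd cycles, a path closes up only to even cycles. -/
theorem StrongOddCycleFree.odd_of_linkedIn {A B : Type*} {R : A → B → Prop}
    (hR : StrongOddCycleFree R) {X : Finset A} {n : ℕ} {q : ℕ → A} (hq : IsLinkedPath R X n q)
    {i : ℕ} (hi : i ≤ n) (hl : LinkedIn R X (q 0) (q i)) : Odd i := by
  by_contra hodd
  rw [Nat.not_odd_iff_even] at hodd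
  obtain ⟨h1, h2, h3⟩ := hq
  obtain ⟨hne, -, -, b₀, hb₀⟩ := hl
  have hi0 : i ≠ 0 := fun h => hne (by rw [h])
  have hi2 : 2 ≤ i := by obtain ⟨r, hr⟩ := hodd; omega
  have : ∀ s, ∃ b, s < n → ∀ a ∈ X, R a b ↔ a = q s ∨ a = q (s + 1) := fun s => by
    by_cases hs : s < n
    · obtain ⟨-, -, -, b, hb⟩ := h3 s hs
      exact ⟨b, fun _ => hb⟩
    · exact ⟨b₀, fun h => absurd h hs⟩
  choose β hβ using this
  refine hR (i + 1) (fun t => q t.val) (fun t => if t.val = i then b₀ else β t.val)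
    (by omega) hodd.add_one fun s t => ?_
  have hs : s.val ≤ i := Nat.lt_succ_iff.1 (ZMod.val_lt s)
  have ht : t.val ≤ i := Nat.lt_succ_iff.1 (ZMod.val_lt t)
  have hinj : ∀ u v : ℕ, u ≤ i → v ≤ i → (q u = q v ↔ u = v) := fun u v hu hv =>
    ⟨h2 u (by omega) v (by omega), fun h => by rw [h]⟩
  have hsucc : (t + 1).val = if t.val = i then 0 else t.val + 1 := by
    rw [ZMod.val_add, ZMod.val_one'' (by omega)]
    split_ifs with h
    · simp [h]
    · exact Nat.mod_eq_of_lt (by omega)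
  rw [← (ZMod.val_injective _).eq_iff, ← (ZMod.val_injective _).eq_iff (a := s) (b := t + 1), hsucc]
  split_ifs with h
  · rw [hb₀ _ (h1 _ (by omega)), hinj _ _ hs (by omega), hinj _ _ hs le_rfl, h]
    exact or_comm
  · rw [hβ _ (by omega) _ (h1 _ (by omega)), hinj _ _ hs ht, hinj _ _ hs (by omega)]

/-- Berge's two-colouring theorem: without strong odd cycles, any finite set can be coloured
with two colours so that everything with two or more incidences sees both colours. -/
theorem StrongOddCycleFree.exists_twoColoring {A B : Type*} {R : A → B → Prop}
    (hR : StrongOddCycleFree R) (X : Finset A) :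
    ∃ g : A → Bool, ∀ b, (∃ x ∈ X, ∃ y ∈ X, x ≠ y ∧ R x b ∧ R y b) →
      ∀ c, ∃ x ∈ X, R x b ∧ g x = c := by
  classical
  induction X using Finset.strongInduction with
  | H X ih =>
  rcases X.eq_empty_or_nonempty with rfl | hX
  · exact ⟨fun _ => true, by simp⟩
  obtain ⟨n, q, hq, hmax⟩ := exists_maximal_isLinkedPath R hX
  have hx : q 0 ∈ X := hq.1 0 (Nat.zero_le _)
  obtain ⟨g, hg⟩ := ih (X.erase (q 0)) (Finset.erase_ssubset hx)
  have halt : ∀ s, 1 ≤ s → s < n → g (q (s + 1)) = !g (q s) := by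
    intro s hs hsn
    obtain ⟨hne, hmem, hmem', b, hb⟩ := hq.2.2 s hsn
    have hs0 : q s ≠ q 0 := fun h => by
      have := hq.2.1 s (by omega) 0 (by omega) h; omega
    have hs0' : q (s + 1) ≠ q 0 := fun h => by
      have := hq.2.1 (s + 1) (by omega) 0 (by omega) h; omega
    obtain ⟨y, hy, hyb, hgy⟩ := hg b ⟨q s, by simp [*], q (s + 1), by simp [*], hne,
      (hb _ hmem).2 (Or.inl rfl), (hb _ hmem').2 (Or.inr rfl)⟩ (!g (q s))
    rcases (hb y (Finset.mem_of_mem_erase hy)).1 hyb with rfl | rfl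
    · simp at hgy
    · exact hgy
  have hpar : ∀ r, 2 * r + 1 ≤ n → g (q (2 * r + 1)) = g (q 1) := by
    intro r
    induction r with
    | zero => simp
    | succ r ihr =>
      intro hr
      have e1 := halt (2 * r + 1) (by omega) (by omega)
      have e2 := halt (2 * r + 1 + 1) (by omega) (by omega)
      rw [show 2 * (r + 1) + 1 = 2 * r + 1 + 1 + 1 by ring, e2, e1, Bool.not_not,
        ihr (by omega)]
  have hnbr : ∀ y, LinkedIn R X (q 0) y → g y = g (q 1) := by
    intro y hy
    obtain ⟨s, hs, rfl⟩ := hmax y hy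
    obtain ⟨r, rfl⟩ := hR.odd_of_linkedIn hq hs hy
    exact hpar r hs
  refine ⟨Function.update g (q 0) (!g (q 1)), fun b hb c => ?_⟩
  by_cases hb' : ∃ x ∈ X.erase (q 0), ∃ y ∈ X.erase (q 0), x ≠ y ∧ R x b ∧ R y b
  · obtain ⟨x, hx, hxb, rfl⟩ := hg b hb' c
    exact ⟨x, Finset.mem_of_mem_erase hx, hxb,
      Function.update_of_ne (Finset.ne_of_mem_erase hx) _ _⟩
  have key : ∃ y ∈ X, y ≠ q 0 ∧ R y b ∧ R (q 0) b ∧ LinkedIn R X (q 0) y := by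
    push Not at hb'
    obtain ⟨x, hxX, y, hyX, hxy, hxb, hyb⟩ := hb
    have main : ∀ y ∈ X, y ≠ q 0 → R y b → R (q 0) b → LinkedIn R X (q 0) y := by
      intro y hyX hy0 hyb h0b
      refine ⟨hy0.symm, hx, hyX, b, fun a ha => ⟨fun hab => ?_, ?_⟩⟩
      · by_contra! hcon
        exact hb' a (by simp [*]) y (by simp [*]) hcon.2 hab hyb
      · rintro (rfl | rfl) <;> assumption
    by_cases hx0 : x = q 0
    · subst hx0
      exact ⟨y, hyX, hxy.symm, hyb, hxb, main y hyX hxy.symm hyb hxb⟩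
    · by_cases hy0 : y = q 0
      · subst hy0
        exact ⟨x, hxX, hxy, hxb, hyb, main x hxX hxy hxb hyb⟩
      · exact absurd hyb (hb' x (by simp [*]) y (by simp [*]) hxy hxb)
  obtain ⟨y, hyX, hy0, hyb, h0b, hl⟩ := key
  by_cases hc : c = g (q 1)
  · exact ⟨y, hyX, hyb, by rw [Function.update_of_ne hy0, hnbr y hl, hc]⟩
  · refine ⟨q 0, hx, h0b, ?_⟩
    rw [Function.update_self]
    cases c <;> simp_all

/-- König's edge-colouring theorem without strong odd cycles: `k` colours suffice as soon as
every degree is at most `k`. -/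
theorem StrongOddCycleFree.exists_coloring {A B : Type*} [Fintype A] [Fintype B]
    {R : A → B → Prop} (hR : StrongOddCycleFree R) (k : ℕ)
    (hne : ∀ a, ∃ b, R a b) (hdeg : ∀ b, {a | R a b}.ncard ≤ k) :
    ∃ col : A → Fin k, ∀ b x y, R x b → R y b → col x = col y → x = y := by
  classical
  have hcard : ∀ b, (univ.filter (R · b)).card ≤ k := fun b => by
    have := hdeg b
    rwa [Set.ncard_eq_toFinset_card', Set.toFinset_ofPred] at this
  have hcol : Nonempty (A → Fin k) := by
    rcases isEmpty_or_nonempty A with hA | ⟨⟨a⟩⟩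
    · exact ⟨fun a => hA.elim a⟩
    · obtain ⟨b, hb⟩ := hne a
      have : 0 < (univ.filter (R · b)).card := Finset.card_pos.2 ⟨a, by simpa using hb⟩
      exact ⟨fun _ => ⟨0, this.trans_le (hcard b)⟩⟩
  obtain ⟨col, hmax⟩ := Finite.exists_max fun col : A → Fin k =>
    ∑ b, ((univ.filter (R · b)).image col).card
  refine ⟨col, fun b x y hx hy hxy => ?_⟩
  by_contra hne
  obtain ⟨c₂, hc₂⟩ : ∃ c₂, c₂ ∉ (univ.filter (R · b)).image col := by
    by_contra! hall
    have h1 : ((univ.filter (R · b)).image col).card = k := by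
      rw [Finset.eq_univ_iff_forall.2 hall, Finset.card_univ, Fintype.card_fin]
    have h2 : ((univ.filter (R · b)).image col).card = (univ.filter (R · b)).card :=
      le_antisymm Finset.card_image_le (by rw [h1]; exact hcard b)
    exact hne (Finset.card_image_iff.1 h2 (by simpa using hx) (by simpa using hy) hxy)
  set c₁ := col x with hc₁
  have hc₁₂ : c₁ ≠ c₂ := fun h => hc₂ (by
    rw [← h]; exact Finset.mem_image_of_mem _ (by simpa using hx))
  obtain ⟨g, hg⟩ := hR.exists_twoColoring (univ.filter fun a => col a = c₁ ∨ col a = c₂)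
  set col' : A → Fin k := fun a =>
    if col a = c₁ ∨ col a = c₂ then (if g a then c₁ else c₂) else col a with hcol'
  have hsub : ∀ d, (∃ x ∈ univ.filter (fun a => col a = c₁ ∨ col a = c₂),
      ∃ y ∈ univ.filter (fun a => col a = c₁ ∨ col a = c₂), x ≠ y ∧ R x d ∧ R y d) →
      insert c₂ ((univ.filter (R · d)).image col) ⊆ (univ.filter (R · d)).image col' := by
    intro d hd c hc
    have htwo : c = c₁ ∨ c = c₂ → c ∈ (univ.filter (R · d)).image col' := by
      rintro (rfl | rfl)
      · obtain ⟨z, hz, hzd, hgz⟩ := hg d hd true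
        exact Finset.mem_image.2 ⟨z, by simpa using hzd, by simp_all⟩
      · obtain ⟨z, hz, hzd, hgz⟩ := hg d hd false
        exact Finset.mem_image.2 ⟨z, by simpa using hzd, by simp_all⟩
    by_cases hcc : c = c₁ ∨ c = c₂
    · exact htwo hcc
    · obtain ⟨z, hz, hzc⟩ := Finset.mem_image.1
        (Finset.mem_of_mem_insert_of_ne hc fun h => hcc (Or.inr h))
      exact Finset.mem_image.2 ⟨z, hz, by rw [← hzc] at hcc ⊢; exact if_neg hcc⟩
  refine absurd (hmax col') (not_le.2 (Finset.sum_lt_sum (fun d _ => ?_) ⟨b, mem_univ b, ?_⟩))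
  · by_cases hd : ∃ x ∈ univ.filter (fun a => col a = c₁ ∨ col a = c₂),
      ∃ y ∈ univ.filter (fun a => col a = c₁ ∨ col a = c₂), x ≠ y ∧ R x d ∧ R y d
    · exact Finset.card_le_card ((Finset.subset_insert _ _).trans (hsub d hd))
    · have hσ : ∃ σ : Equiv.Perm (Fin k), ∀ a, R a d → col' a = σ (col a) := by
        by_cases hz : ∃ z, R z d ∧ (col z = c₁ ∨ col z = c₂)
        · obtain ⟨z, hzd, hzc⟩ := hz
          refine ⟨Equiv.swap (col z) (col' z), fun a had => ?_⟩
          by_cases haz : a = z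
          · rw [haz, Equiv.swap_apply_left]
          · have hac : ¬ (col a = c₁ ∨ col a = c₂) := fun hac =>
              hd ⟨a, by simpa using hac, z, by simpa using hzc, haz, had, hzd⟩
            have hz' : col' z = c₁ ∨ col' z = c₂ := by
              rw [hcol']; dsimp only; rw [if_pos hzc]; split_ifs <;> simp
            rw [Equiv.swap_apply_of_ne_of_ne]
            · exact if_neg hac
            · exact fun h => hac (h ▸ hzc)
            · exact fun h => hac (h ▸ hz')
        · push Not at hz
          exact ⟨1, fun a had => if_neg (by simpa using hz a had)⟩
      obtain ⟨σ, hσ⟩ := hσ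
      have : (univ.filter (R · d)).image col' = ((univ.filter (R · d)).image col).image σ := by
        rw [Finset.image_image]
        exact Finset.image_congr fun a ha => hσ a (by simpa using ha)
      rw [this, Finset.card_image_of_injective _ σ.injective]
  · have := Finset.card_le_card (hsub b ⟨x, by simp [hc₁], y, by simp [← hxy], hne, hx, hy⟩)
    rw [Finset.card_insert_of_notMem hc₂] at this
    exact this

/-- `N` is a matching: no two distinct members of `N` share an incidence. -/
def IsIncidenceMatching {E V : Type*} (R : E → V → Prop) (N : Finset E) : Prop :=
  ∀ e ∈ N, ∀ e' ∈ N, ∀ v, R e v → R e' v → e = e'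

/-- An integral multiset of edges with degrees at most `k` weighs at most `k` times the
maximal weight of a matching. -/
theorem StrongOddCycleFree.sum_natCast_mul_le {E V : Type*} [Fintype E] [Fintype V]
    {R : E → V → Prop} [∀ e v, Decidable (R e v)] (hR : StrongOddCycleFree R)
    (hne : ∀ e, ∃ v, R e v) (c : E → ℝ) {P : ℝ}
    (hP : ∀ N, IsIncidenceMatching R N → ∑ e ∈ N, c e ≤ P) (m : E → ℕ) (k : ℕ)
    (hdeg : ∀ v, ∑ e with R e v, m e ≤ k) : ∑ e, (m e : ℝ) * c e ≤ k * P := by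
  classical
  have hR' : StrongOddCycleFree fun (a : Σ e, Fin (m e)) v => R a.1 v :=
    fun n a b hn ho h => hR n (fun i => (a i).1) b hn ho h
  obtain ⟨col, hcol⟩ := hR'.exists_coloring k (fun a => hne a.1) fun v => by
    refine le_trans (le_of_eq ?_) (hdeg v)
    rw [Set.ncard_eq_toFinset_card', Set.toFinset_ofPred]
    have : (univ.filter fun a : Σ e, Fin (m e) => R a.1 v) =
        (univ.filter (R · v)).sigma fun _ => univ := by
      ext; simp
    rw [this, Finset.card_sigma]
    simp
  have hsum : ∑ e, (m e : ℝ) * c e = ∑ a : Σ e, Fin (m e), c a.1 := by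
    rw [Fintype.sum_sigma]
    simp
  have hclass : ∀ i, ∑ a with col a = i, c a.1 ≤ P := by
    intro i
    have hinj : Set.InjOn Sigma.fst
        (univ.filter (fun a => col a = i) : Set (Σ e, Fin (m e))) := by
      intro a ha b hb hab
      obtain ⟨v, hv⟩ := hne a.1
      simp only [coe_filter_univ, Set.mem_ofPred_eq] at ha hb
      exact hcol v a b hv (hab ▸ hv) (ha.trans hb.symm)
    rw [← Finset.sum_image (f := c) hinj]
    refine hP _ ?_
    intro e he e' he' v hev hev'
    obtain ⟨a, ha, rfl⟩ := Finset.mem_image.1 he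
    obtain ⟨b, hb, rfl⟩ := Finset.mem_image.1 he'
    simp only [mem_filter, mem_univ, true_and] at ha hb
    rw [hcol v a b hev hev' (ha.trans hb.symm)]
  calc ∑ e, (m e : ℝ) * c e = ∑ i, ∑ a with col a = i, c a.1 := by
        rw [hsum, Finset.sum_fiberwise]
    _ ≤ ∑ _i : Fin k, P := Finset.sum_le_sum fun i _ => hclass i
    _ = k * P := by simp

/-- A nonnegative weighting of edges with weighted degrees at most `s` weighs at most `s`
times the maximal weight of a matching. -/
theorem StrongOddCycleFree.sum_mul_le {E V : Type*} [Fintype E] [Fintype V]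
    {R : E → V → Prop} [∀ e v, Decidable (R e v)] (hR : StrongOddCycleFree R)
    (hne : ∀ e, ∃ v, R e v) (c : E → ℝ) {P : ℝ}
    (hP : ∀ N, IsIncidenceMatching R N → ∑ e ∈ N, c e ≤ P) (x : E → ℝ) (hx : ∀ e, 0 ≤ x e)
    {s : ℝ} (hs : 0 ≤ s) (hdeg : ∀ v, ∑ e with R e v, x e ≤ s) :
    ∑ e, x e * c e ≤ s * P := by
  have hP0 : 0 ≤ P := by simpa using hP ∅ (by simp [IsIncidenceMatching])
  have key : ∀ n : ℕ, n • (∑ e, x e * c e - s * P) ≤ ∑ e, |c e| := by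
    intro n
    have h1 := hR.sum_natCast_mul_le hne c hP (fun e => ⌊n * x e⌋₊) ⌊n * s⌋₊ fun v => by
      refine Nat.le_floor ?_
      push_cast
      calc ∑ e with R e v, (⌊n * x e⌋₊ : ℝ) ≤ ∑ e with R e v, n * x e :=
            Finset.sum_le_sum fun e _ => Nat.floor_le (mul_nonneg n.cast_nonneg (hx e))
        _ = n * ∑ e with R e v, x e := by rw [Finset.mul_sum]
        _ ≤ n * s := mul_le_mul_of_nonneg_left (hdeg v) n.cast_nonneg
    have h2 : (⌊n * s⌋₊ : ℝ) * P ≤ n * s * P :=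
      mul_le_mul_of_nonneg_right (Nat.floor_le (mul_nonneg n.cast_nonneg hs)) hP0
    have h3 : n * ∑ e, x e * c e ≤ ∑ e, (⌊n * x e⌋₊ : ℝ) * c e + ∑ e, |c e| := by
      rw [Finset.mul_sum, ← Finset.sum_add_distrib]
      refine Finset.sum_le_sum fun e _ => ?_
      have hle := Nat.floor_le (mul_nonneg n.cast_nonneg (hx e))
      have hlt := Nat.lt_floor_add_one (n * x e)
      have : (n * x e - ⌊n * x e⌋₊) * c e ≤ 1 * |c e| :=
        mul_le_mul_of_nonneg (by linarith) (le_abs_self _) (by linarith) (abs_nonneg _)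
      linarith
    rw [nsmul_eq_mul]
    linarith
  by_contra! hlt
  obtain ⟨n, hn⟩ := Archimedean.arch (∑ e, |c e| + 1) (sub_pos.2 hlt)
  linarith [key n]

/-- Integral duality without strong odd cycles: some matching is as heavy as some fractional
cover of the edge weights. -/
theorem StrongOddCycleFree.exists_matching_cover {E V : Type*} [Fintype E] [Fintype V]
    {R : E → V → Prop} [∀ e v, Decidable (R e v)] (hR : StrongOddCycleFree R)
    (hne : ∀ e, ∃ v, R e v) (c : E → ℝ) :
    ∃ (N : Finset E) (y : V → ℝ), IsIncidenceMatching R N ∧ (∀ v, 0 ≤ y v) ∧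
      (∀ e, c e ≤ ∑ v with R e v, y v) ∧ ∑ v, y v ≤ ∑ e ∈ N, c e := by
  classical
  obtain ⟨N, hN, hmax⟩ := (univ.filter (IsIncidenceMatching R)).exists_max_image
    (fun N => ∑ e ∈ N, c e) ⟨∅, by simp [IsIncidenceMatching]⟩
  simp only [mem_filter, mem_univ, true_and] at hN hmax
  set P := ∑ e ∈ N, c e with hP
  by_contra! hcon
  -- slacks of the cover constraints and of the budget constraint
  let Φ : (V → ℝ) → Option E → ℝ := fun y o =>
    o.elim (P - ∑ v, y v) fun e => ∑ v with R e v, y v - c e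
  let box : Set (V → ℝ) := Set.Icc 0 fun _ => P
  have hbox : IsCompact (Φ '' box) := isCompact_Icc.image <| continuous_pi fun o => by
    cases o <;> simp only [Φ, Option.elim] <;> fun_prop
  have hconv : Convex ℝ (Φ '' box) := by
    rintro _ ⟨y, hy, rfl⟩ _ ⟨z, hz, rfl⟩ a b ha hb hab
    refine ⟨a • y + b • z, convex_Icc _ _ hy hz ha hb hab, ?_⟩
    ext o
    cases o with
    | none =>
      simp only [Φ, Option.elim, Pi.add_apply, Pi.smul_apply, smul_eq_mul,
        Finset.sum_add_distrib, ← Finset.mul_sum]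
      linear_combination -P * hab
    | some e =>
      simp only [Φ, Option.elim, Pi.add_apply, Pi.smul_apply, smul_eq_mul,
        Finset.sum_add_distrib, ← Finset.mul_sum]
      linear_combination c e * hab
  have hdisj : Disjoint (Φ '' box) (Set.Ici 0) := by
    rw [Set.disjoint_left]
    rintro _ ⟨y, hy, rfl⟩ h
    have h1 := hcon N y hN hy.1 fun e => sub_nonneg.1 (h (some e))
    have h2 : 0 ≤ P - ∑ v, y v := h none
    linarith
  obtain ⟨f, u, w, hf, huw, hw⟩ := geometric_hahn_banach_compact_closed hconv hbox
    (convex_Ici (0 : Option E → ℝ)) isClosed_Ici hdisj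
  have hw0 : w < 0 := by simpa using hw 0 (Set.mem_Ici.2 le_rfl)
  have hrep : ∀ z : Option E → ℝ, f z = z none * f (Pi.single none 1) +
      ∑ e, z (some e) * f (Pi.single (some e) 1) := fun z => by
    have := LinearMap.pi_apply_eq_sum_univ (f : (Option E → ℝ) →ₗ[ℝ] ℝ) z
    rw [Fintype.sum_option] at this
    simp only [smul_eq_mul, ContinuousLinearMap.coe_coe] at this
    convert this using 4 <;> (try congr) <;> (ext j; simp [Pi.single_apply, eq_comm])
  have hnonneg : ∀ o, 0 ≤ f (Pi.single o 1) := fun o => by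
    by_contra! hneg
    have := hw ((w / f (Pi.single o 1)) • Pi.single o 1) (Set.mem_Ici.2
      (smul_nonneg (div_nonneg_of_nonpos hw0.le hneg.le) (Pi.single_nonneg.2 zero_le_one)))
    rw [map_smul, smul_eq_mul, div_mul_cancel₀ _ hneg.ne] at this
    exact lt_irrefl _ this
  set s := f (Pi.single none 1) with hs
  set x : E → ℝ := fun e => f (Pi.single (some e) 1) with hx
  set D := ∑ v, max (∑ e with R e v, x e - s) 0 with hD
  have hD0 : 0 ≤ D := Finset.sum_nonneg fun _ _ => le_max_right _ _
  have hfrac := hR.sum_mul_le hne c hmax x (fun e => hnonneg _)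
    (add_nonneg (hnonneg none) hD0) fun v => by
      have h1 : max (∑ e with R e v, x e - s) 0 ≤ D :=
        Finset.single_le_sum (f := fun v => max (∑ e with R e v, x e - s) 0)
          (fun _ _ => le_max_right _ _) (mem_univ v)
      have h2 := le_max_left (∑ e with R e v, x e - s) 0
      linarith
  have hP0 : 0 ≤ P := by simpa using hmax ∅ (by simp [IsIncidenceMatching])
  let y : V → ℝ := fun v => if s < ∑ e with R e v, x e then P else 0
  have hy : y ∈ box := by
    constructor <;> intro v <;> simp only [y, Pi.zero_apply] <;> split_ifs <;> simp [hP0]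
  have hlt := (hf _ ⟨y, hy, rfl⟩).trans (huw.trans hw0)
  rw [hrep] at hlt
  have hswap : ∑ e, (∑ v with R e v, y v) * x e = ∑ v, y v * ∑ e with R e v, x e := by
    simp only [Finset.sum_filter, Finset.sum_mul, Finset.mul_sum]
    rw [Finset.sum_comm]
    simp
  have hexcess : ∑ v, y v * ∑ e with R e v, x e - s * ∑ v, y v = P * D := by
    rw [hD, Finset.mul_sum, Finset.mul_sum, ← Finset.sum_sub_distrib]
    refine Finset.sum_congr rfl fun v _ => ?_
    simp only [y]
    split_ifs with h
    · rw [max_eq_left (by linarith)]; ring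
    · rw [max_eq_right (by linarith)]; ring
  have hexpand : (Φ y none) * s + ∑ e, (Φ y (some e)) * x e =
      (P - ∑ v, y v) * s + (∑ v, y v * ∑ e with R e v, x e - ∑ e, x e * c e) := by
    simp only [Φ, Option.elim, sub_mul, Finset.sum_sub_distrib, hswap]
    simp only [mul_comm]
  have : (Φ y none) * s + ∑ e, (Φ y (some e)) * x e < 0 := hlt
  nlinarith

/-- Complementary slackness for a matching and a cover of at most the same weight. -/
theorem complementary_slackness {E V : Type*} [Fintype V] {R : E → V → Prop}
    [∀ e v, Decidable (R e v)] {c : E → ℝ} {N : Finset E} {y : V → ℝ}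
    (hN : IsIncidenceMatching R N) (hy : ∀ v, 0 ≤ y v)
    (hc : ∀ e, c e ≤ ∑ v with R e v, y v) (hle : ∑ v, y v ≤ ∑ e ∈ N, c e) :
    (∀ e ∈ N, c e = ∑ v with R e v, y v) ∧ ∀ v, (∀ e ∈ N, ¬ R e v) → y v = 0 := by
  classical
  have hdisj : (N : Set E).PairwiseDisjoint fun e => univ.filter (R e) := by
    intro e he e' he' hne
    refine Finset.disjoint_left.2 fun v hv hv' => hne (hN e he e' he' v ?_ ?_) <;> simp_all
  have h1 : ∑ e ∈ N, c e ≤ ∑ e ∈ N, ∑ v with R e v, y v := Finset.sum_le_sum fun e _ => hc e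
  have h2 : ∑ e ∈ N, ∑ v with R e v, y v + ∑ v ∈ (N.biUnion fun e => univ.filter (R e))ᶜ, y v =
      ∑ v, y v := by
    rw [← Finset.sum_biUnion hdisj, Finset.sum_add_sum_compl]
  have h3 : 0 ≤ ∑ v ∈ (N.biUnion fun e => univ.filter (R e))ᶜ, y v :=
    Finset.sum_nonneg fun v _ => hy v
  refine ⟨(Finset.sum_eq_sum_iff_of_le fun e _ => hc e).1 (by linarith), fun v hv => ?_⟩
  exact (Finset.sum_eq_zero_iff_of_nonneg fun v _ => hy v).1 (by linarith) v (by simpa using hv)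

/-- A hypergraph without nontrivial odd-length cycle has no strong odd cycle in the
incidence relation of any family of its edges. -/
theorem strongOddCycleFree_of_not_hasNontrivialOddCycle {V I : Type*}
    {edges : Finset V → Prop} (h : ¬ HasNontrivialOddCycle edges) (E : I → Finset V)
    (hE : ∀ i, edges (E i)) : StrongOddCycleFree fun i v => v ∈ E i := by
  intro k a b hk hodd hab
  have htwo : (2 : ZMod k) ≠ 0 := fun h2 => by
    have := Nat.le_of_dvd two_pos ((ZMod.natCast_eq_zero_iff 2 k).1 (by exact_mod_cast h2))
    omega
  have hcross : ∀ t t' : ZMod k, t = t' + 1 → t' = t + 1 → False := fun t t' h1 h2 =>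
    htwo (by linear_combination -h1 - h2)
  have hb : Function.Injective b := by
    intro t t' htt
    rcases (hab t t').1 (htt ▸ (hab t t).2 (Or.inl rfl)) with h1 | h1
    · exact h1
    rcases (hab t' t).1 (htt ▸ (hab t' t').2 (Or.inl rfl)) with h2 | h2
    · exact h2.symm
    exact (hcross _ _ h1 h2).elim
  have ha : Function.Injective fun i => E (a (i + 1)) := by
    intro t t' htt
    have htt' : E (a (t + 1)) = E (a (t' + 1)) := htt
    have h1 : b t ∈ E (a (t' + 1)) := htt' ▸ (hab (t + 1) t).2 (Or.inr rfl)
    have h2 : b t' ∈ E (a (t + 1)) := htt' ▸ (hab (t' + 1) t').2 (Or.inr rfl)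
    rcases (hab _ _).1 h1 with h1 | h1
    · rcases (hab _ _).1 h2 with h2 | h2
      · exact (hcross _ _ h1.symm h2.symm).elim
      · exact add_right_cancel h2
    · exact (add_right_cancel h1).symm
  refine h ⟨k, b, fun i => E (a (i + 1)), ⟨by omega, hb, ha, fun i => hE _, fun i =>
    ⟨(hab _ _).2 (Or.inr rfl), (hab _ _).2 (Or.inl rfl)⟩⟩, hodd, fun i t hit => ?_⟩
  rcases (hab _ _).1 hit with h1 | h1
  · exact Or.inr h1.symm
  · exact Or.inl (add_right_cancel h1).symm

/-- A stable matching exists in a matching market with transferable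
utilities if the firm-worker hypergraph has no nontrivial odd-length cycle. -/
theorem stmt0 {F W : Type*} [Fintype F] [Fintype W] [DecidableEq F] [DecidableEq W]
    (M : TUMarket F W)
    (h : ¬ HasNontrivialOddCycle M.fwEdges) :
    ∃ (μ : W → Option F) (p : W → ℝ), M.Stable μ p := by
  classical
  let I := {e : F × Finset W // e.2 ∈ M.acc e.1 ∧ ∀ w ∈ e.2, e.1 ∈ M.accW w}
  let E : I → Finset (F ⊕ W) := fun e => insert (Sum.inl e.1.1) (e.1.2.image Sum.inr)
  have hR := strongOddCycleFree_of_not_hasNontrivialOddCycle h E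
    fun e => ⟨e.1.1, e.1.2, e.2.1, rfl⟩
  let c : I → ℝ := fun e => M.vF e.1.1 e.1.2 + ∑ w ∈ e.1.2, M.vW w (some e.1.1)
  obtain ⟨N, y, hN, hy, hc, hle⟩ := hR.exists_matching_cover
    (fun e => ⟨Sum.inl e.1.1, Finset.mem_insert_self _ _⟩) c
  obtain ⟨htight, hzero⟩ := complementary_slackness hN hy hc hle
  have hl : ∀ (e : I) f, Sum.inl f ∈ E e ↔ f = e.1.1 := fun e f => by simp [E]
  have hr : ∀ (e : I) w, Sum.inr w ∈ E e ↔ w ∈ e.1.2 := fun e w => by simp [E]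
  have hsum : ∀ e : I, ∑ v with v ∈ E e, y v =
      y (Sum.inl e.1.1) + ∑ w ∈ e.1.2, y (Sum.inr w) := fun e => by
    have : (univ.filter fun v => v ∈ E e) = E e := by ext; simp
    rw [this, Finset.sum_insert (by simp), Finset.sum_image (by simp)]
  simp only [hsum] at htight hc
  have hμ : ∀ w, ∃ o : Option F, (∀ e ∈ N, w ∈ e.1.2 → o = some e.1.1) ∧
      ∀ f, o = some f → ∃ e ∈ N, w ∈ e.1.2 ∧ e.1.1 = f := by
    intro w
    by_cases hw : ∃ e ∈ N, w ∈ e.1.2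
    · obtain ⟨e, he, hwe⟩ := hw
      refine ⟨some e.1.1, fun e' he' hwe' => ?_, fun f hf => ⟨e, he, hwe, Option.some.inj hf⟩⟩
      rw [hN e he e' he' (Sum.inr w) ((hr _ _).2 hwe) ((hr _ _).2 hwe')]
    · exact ⟨none, fun e he hwe => absurd ⟨e, he, hwe⟩ hw, by simp⟩
  choose μ hμN hμs using hμ
  have hassigned : ∀ e ∈ N, assignedSet μ e.1.1 = e.1.2 := by
    intro e he
    ext w
    simp only [assignedSet, mem_filter, mem_univ, true_and]
    refine ⟨fun hw => ?_, hμN w e he⟩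
    obtain ⟨e', he', hwe', hf⟩ := hμs w _ hw
    rwa [hN e he e' he' (Sum.inl e.1.1) ((hl _ _).2 rfl) ((hl _ _).2 hf.symm)]
  have hunassigned : ∀ f, (∀ e ∈ N, e.1.1 ≠ f) → assignedSet μ f = ∅ := by
    intro f hf
    rw [Finset.eq_empty_iff_forall_notMem]
    intro w hw
    obtain ⟨e, he, -, hef⟩ := hμs w f (by simpa [assignedSet] using hw)
    exact hf e he hef
  let p : W → ℝ := fun w => y (Sum.inr w) - M.vW w (μ w)
  have hUw : ∀ w, M.Uw w (μ w) p = y (Sum.inr w) := fun w => by simp [TUMarket.Uw, p]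
  have hUf : ∀ f, M.Uf f (assignedSet μ f) p = y (Sum.inl f) := by
    intro f
    by_cases hf : ∃ e ∈ N, e.1.1 = f
    · obtain ⟨e, he, rfl⟩ := hf
      have hp : ∑ w ∈ e.1.2, p w =
          ∑ w ∈ e.1.2, y (Sum.inr w) - ∑ w ∈ e.1.2, M.vW w (some e.1.1) := by
        rw [← Finset.sum_sub_distrib]
        exact Finset.sum_congr rfl fun w hw => by rw [← hμN w e he hw]
      have ht : M.vF e.1.1 e.1.2 + ∑ w ∈ e.1.2, M.vW w (some e.1.1) =
        y (Sum.inl e.1.1) + ∑ w ∈ e.1.2, y (Sum.inr w) := htight e he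
      rw [hassigned e he, TUMarket.Uf, hp]
      linarith
    · push Not at hf
      rw [hunassigned f hf, hzero (Sum.inl f) fun e he hfe => hf e he ((hl _ _).1 hfe).symm]
      simp [TUMarket.Uf, M.vF_empty]
  refine ⟨μ, p, fun w hw => ?_, ⟨fun w => ⟨fun f hf => ?_, ?_⟩, fun f => ⟨?_, ?_⟩⟩, ?_⟩
  · have hyw := hzero (Sum.inr w) fun e he hwe => by
      simpa [hw] using hμN w e he ((hr _ _).1 hwe)
    simp [p, hw, hyw, M.vW_none]
  · obtain ⟨e, -, hwe, rfl⟩ := hμs w f hf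
    exact e.2.2 w hwe
  · rw [hUw]; exact hy _
  · by_cases hf : ∃ e ∈ N, e.1.1 = f
    · obtain ⟨e, he, rfl⟩ := hf
      exact Or.inr (by rw [hassigned e he]; exact e.2.1)
    · push Not at hf
      exact Or.inl (hunassigned f hf)
  · rw [hUf]; exact hy _
  · rintro ⟨f, S, p', hS, hSw, hf, hw, hstrict⟩
    simp only [hUf, hUw] at hf hw hstrict
    have hcov : M.vF f S + ∑ w ∈ S, M.vW w (some f) ≤
      y (Sum.inl f) + ∑ w ∈ S, y (Sum.inr w) := hc ⟨(f, S), hS, hSw⟩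
    have htotal : M.Uf f S p' + ∑ w ∈ S, M.Uw w (some f) p' =
        M.vF f S + ∑ w ∈ S, M.vW w (some f) := by
      simp only [TUMarket.Uf, TUMarket.Uw, Finset.sum_add_distrib]
      ring
    rcases hstrict with hlt | hlt
    · linarith [Finset.sum_le_sum hw]
    · linarith [Finset.sum_lt_sum hw hlt]
end

section
/- Let a discrete many-to-one matching market be given. If the firm-worker hypergraph of the market has no nontrivial odd-length cycle, then a stable matching exists. -/
open Finset


/-- A discrete many-to-one matching market: firms `F`, workers `W`; each worker `w`
has a strict (total) preference `pw w` over `Option F` (`none` = unmatched); each firm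
`f` has a strict (total) preference `pf f` over subsets of `W`; `Ch f S` is the
`pf f`-maximal subset of `S`. Here `pw w a b` (resp. `pf f A B`) means `a ≻_w b`
(resp. `A ≻_f B`). -/
structure DMarket (F W : Type*) [Fintype W] [DecidableEq F] [DecidableEq W] where
  pw : W → Option F → Option F → Prop
  pw_sto : ∀ w, IsStrictTotalOrder (Option F) (pw w)
  pf : F → Finset W → Finset W → Prop
  pf_sto : ∀ f, IsStrictTotalOrder (Finset W) (pf f)
  Ch : F → Finset W → Finset W
  Ch_subset : ∀ f S, Ch f S ⊆ S
  Ch_max : ∀ f S S', S' ⊆ S → S' ≠ Ch f S → pf f (Ch f S) S'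

namespace DMarket

variable {F W : Type*} [Fintype W] [DecidableEq F] [DecidableEq W]

/-- `S` is satisfactory to firm `f`: `S` is nonempty and `Ch f S = S`. -/
def Satisf (M : DMarket F W) (f : F) (S : Finset W) : Prop :=
  S.Nonempty ∧ M.Ch f S = S

/-- Individual rationality of a matching `μ`: every worker weakly prefers her match to
being unmatched, and every firm chooses its whole assigned set. -/
def IndivRat (M : DMarket F W) (μ : W → Option F) : Prop :=
  (∀ w, μ w = none ∨ M.pw w (μ w) none) ∧
  (∀ f, M.Ch f (assignedSet μ f) = assignedSet μ f)

/-- `(f, S)` is a blocking coalition for `μ`: every worker in `S` weakly prefers `f` to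
her current match, and `f` strictly prefers `S` to its current assigned set. -/
def Blocks (M : DMarket F W) (μ : W → Option F) (f : F) (S : Finset W) : Prop :=
  (∀ w ∈ S, μ w = some f ∨ M.pw w (some f) (μ w)) ∧ M.pf f S (assignedSet μ f)

/-- Stability of a matching `μ` in a discrete matching market. -/
def Stable (M : DMarket F W) (μ : W → Option F) : Prop :=
  M.IndivRat μ ∧ ¬ ∃ f S, M.Blocks μ f S

/-- The firm-worker hypergraph of a discrete market: vertices `F ⊕ W`, and an edge
`{f} ∪ S` for each firm `f` and each satisfactory set `S` of `f`. -/
def fwEdges (M : DMarket F W) (e : Finset (F ⊕ W)) : Prop :=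
  ∃ f S, M.Satisf f S ∧ e = insert (Sum.inl f) (S.image Sum.inr)

end DMarket

/-- An incidence relation is balanced if it contains no odd cycle, of length at least three,
each of whose members is incident with exactly two of the cycle's elements. -/
def IsBalancedInc {I T : Type*} (inc : I → T → Prop) : Prop :=
  ∀ (k : ℕ) (t : ZMod k → T) (i : ZMod k → I), 3 ≤ k → Odd k →
    ¬ ∀ a b, inc (i b) (t a) ↔ a = b ∨ a = b + 1

namespace IsBalancedInc

variable {I T : Type*} {inc : I → T → Prop}

/-- The graph on `U` whose edges are the traces on `U` of the rows with exactly two elements. -/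
def pairGraph (inc : I → T → Prop) (U : Finset T) : SimpleGraph T where
  Adj s s' := s ≠ s' ∧ s ∈ U ∧ s' ∈ U ∧ ∃ i, ∀ x ∈ U, inc i x ↔ x = s ∨ x = s'
  symm := ⟨fun _ _ ⟨hne, hs, hs', i, hi⟩ =>
    ⟨hne.symm, hs', hs, i, fun x hx => (hi x hx).trans or_comm⟩⟩
  loopless := ⟨fun _ h => h.1 rfl⟩

lemma even_length_of_isPath (hB : IsBalancedInc inc) {U : Finset T} {v u u' : T}
    (hu : (pairGraph inc U).Adj v u) (hu' : (pairGraph inc U).Adj v u')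
    (p : (pairGraph inc U).Walk u u') (hp : p.IsPath) (hv : v ∉ p.support) :
    Even p.length := by
  by_contra hodd
  rw [Nat.not_even_iff_odd] at hodd
  have hpos : 0 < p.length := hodd.pos
  let t : Fin (p.length + 2) → T := fun a => if a.val = 0 then v else p.getVert (a.val - 1)
  have ht0 : ∀ a : Fin (p.length + 2), a.val = 0 → t a = v := fun a ha => if_pos ha
  have hts : ∀ a : Fin (p.length + 2), a.val ≠ 0 → t a = p.getVert (a.val - 1) :=
    fun a ha => if_neg ha
  have htv : ∀ a : Fin (p.length + 2), a.val ≠ 0 → t a ≠ v := by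
    intro a ha h
    rw [hts a ha] at h
    exact hv (h ▸ p.getVert_mem_support _)
  have hinj : Function.Injective t := by
    intro a b hab
    by_cases ha : a.val = 0
    · by_cases hb : b.val = 0
      · exact Fin.ext (ha.trans hb.symm)
      · exact absurd ((hab.symm.trans (ht0 a ha))) (htv b hb)
    · by_cases hb : b.val = 0
      · exact absurd (hab.trans (ht0 b hb)) (htv a ha)
      · rw [hts a ha, hts b hb] at hab
        have h1 : a.val - 1 ≤ p.length := by have := a.2; omega
        have h2 : b.val - 1 ≤ p.length := by have := b.2; omega
        have := hp.getVert_injOn h1 h2 hab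
        exact Fin.ext (by omega)
  have hadj : ∀ b, (pairGraph inc U).Adj (t b) (t (b + 1)) := by
    intro b
    have hval := Fin.val_add_one b
    by_cases hlast : b = Fin.last _
    · rw [if_pos hlast] at hval
      have hb : b.val = p.length + 1 := by rw [hlast]; rfl
      rw [ht0 _ hval, hts b (by omega), hb]
      simpa using hu'.symm
    · rw [if_neg hlast] at hval
      have hb : b.val < p.length + 1 := by
        have h1 : b.val ≠ p.length + 1 := fun h => hlast (Fin.ext h)
        have h2 := b.2
        omega
      rw [hts (b + 1) (by rw [hval]; exact Nat.succ_ne_zero _), hval]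
      by_cases h0 : b.val = 0
      · rw [ht0 b h0, h0]
        simpa using hu
      · rw [hts b h0]
        have := p.adj_getVert_succ (i := b.val - 1) (by omega)
        rwa [show b.val - 1 + 1 = b.val + 1 - 1 by omega] at this
  choose i hi using fun b => (hadj b).2.2.2
  refine hB (p.length + 2) t i (by omega) (by simpa [Nat.odd_add, parity_simps] using hodd) ?_
  intro a b
  have := hi b (t a) (hadj a).2.1
  rw [this]
  exact or_congr hinj.eq_iff hinj.eq_iff

lemma exists_forall_adj_avoiding_path [Finite T] (G : SimpleGraph T) {U : Finset T}
    (hG : ∀ s s', G.Adj s s' → s' ∈ U) (hU : U.Nonempty) :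
    ∃ v ∈ U, ∀ u u', G.Adj v u → G.Adj v u' → ∃ p : G.Walk u u', p.IsPath ∧ v ∉ p.support := by
  classical
  obtain ⟨r, hr⟩ := hU
  obtain ⟨v, hv, hmax⟩ := (U.filter (G.Reachable r)).exists_max_image (G.dist r)
    ⟨r, by simp [hr]⟩
  rw [Finset.mem_filter] at hv
  have key : ∀ u, G.Adj v u → ∃ q : G.Walk r u, v ∉ q.support := by
    intro u hu
    have hru : G.Reachable r u := hv.2.trans hu.reachable
    obtain ⟨q, hq⟩ := hru.exists_walk_length_eq_dist
    refine ⟨q, fun hmem => ?_⟩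
    have h1 := q.length_takeUntil_lt_length hmem hu.ne
    have h2 := SimpleGraph.dist_le (q.takeUntil v hmem)
    have h3 := hmax u (by simp [hG _ _ hu, hru])
    omega
  refine ⟨v, hv.1, fun u u' hu hu' => ?_⟩
  obtain ⟨q, hq⟩ := key u hu
  obtain ⟨q', hq'⟩ := key u' hu'
  refine ⟨(q.reverse.append q').bypass, SimpleGraph.Walk.bypass_isPath _, fun hmem => ?_⟩
  have := SimpleGraph.Walk.support_bypass_subset_support _ hmem
  simp [SimpleGraph.Walk.mem_support_append_iff, hq, hq'] at this

/-- Berge's theorem: a balanced incidence relation has a two-colouring in which every row with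
at least two elements sees both colours. -/
theorem exists_twoColoring [Finite T] (hB : IsBalancedInc inc) (U : Finset T) :
    ∃ col : T → Bool, ∀ i, ∀ t₁ ∈ U, ∀ t₂ ∈ U, t₁ ≠ t₂ → inc i t₁ → inc i t₂ →
      ∃ s₁ ∈ U, ∃ s₂ ∈ U, inc i s₁ ∧ inc i s₂ ∧ col s₁ ≠ col s₂ := by
  classical
  induction U using Finset.strongInduction with
  | H U ih =>
  rcases U.eq_empty_or_nonempty with rfl | hU
  · exact ⟨fun _ => true, by simp⟩
  obtain ⟨v, hvU, hv⟩ := exists_forall_adj_avoiding_path (pairGraph inc U) (U := U)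
    (fun _ _ h => h.2.2.1) hU
  obtain ⟨col, hcol⟩ := ih (U.erase v) (Finset.erase_ssubset hvU)
  have halt : ∀ s s', (pairGraph inc U).Adj s s' → s ≠ v → s' ≠ v → col s' = !col s := by
    rintro s s' ⟨hne, hs, hs', i, hi⟩ hsv hsv'
    obtain ⟨s₁, h₁, s₂, h₂, hi₁, hi₂, hd⟩ := hcol i s (by simp [*]) s' (by simp [*]) hne
      ((hi s hs).2 (Or.inl rfl)) ((hi s' hs').2 (Or.inr rfl))
    rw [hi _ (Finset.mem_of_mem_erase h₁)] at hi₁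
    rw [hi _ (Finset.mem_of_mem_erase h₂)] at hi₂
    rcases hi₁ with rfl | rfl <;> rcases hi₂ with rfl | rfl
    · exact absurd rfl hd
    · revert hd; cases col s₁ <;> cases col s₂ <;> simp
    · revert hd; cases col s₁ <;> cases col s₂ <;> simp
    · exact absurd rfl hd
  have hnb : ∀ u u', (pairGraph inc U).Adj v u → (pairGraph inc U).Adj v u' →
      col u = col u' := by
    intro u u' hu hu'
    by_contra hne
    obtain ⟨p, hp, hpv⟩ := hv u u' hu hu'
    have hpn : ∀ n, p.getVert n ≠ v := fun n h => hpv (h ▸ p.getVert_mem_support n)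
    have hlen := hB.even_length_of_isPath hu hu' p hp hpv
    have hstep : ∀ n ≤ p.length, (col (p.getVert n) = col u ↔ Even n) := by
      intro n
      induction n with
      | zero => simp
      | succ n ihn =>
        intro hn
        rw [halt _ _ (p.adj_getVert_succ (by omega)) (hpn _) (hpn _), Nat.even_add_one,
          ← ihn (by omega)]
        cases col (p.getVert n) <;> cases col u <;> simp
    have := (hstep _ le_rfl).2 hlen
    rw [p.getVert_length] at this
    exact hne this.symm
  obtain ⟨c, hc⟩ : ∃ c, ∀ u, (pairGraph inc U).Adj v u → col u = c := by
    by_cases h : ∃ u, (pairGraph inc U).Adj v u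
    · obtain ⟨u, hu⟩ := h
      exact ⟨col u, fun u' hu' => hnb _ _ hu' hu⟩
    · exact ⟨true, fun u hu => absurd ⟨u, hu⟩ h⟩
  refine ⟨Function.update col v (!c), fun i t₁ h₁ t₂ h₂ hne hi₁ hi₂ => ?_⟩
  by_cases hpair : ∃ a ∈ U.erase v, ∃ b ∈ U.erase v, a ≠ b ∧ inc i a ∧ inc i b
  · obtain ⟨a, ha, b, hb, hab, hia, hib⟩ := hpair
    obtain ⟨s₁, hs₁, s₂, hs₂, his₁, his₂, hd⟩ := hcol i a ha b hb hab hia hib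
    refine ⟨s₁, Finset.mem_of_mem_erase hs₁, s₂, Finset.mem_of_mem_erase hs₂, his₁, his₂, ?_⟩
    rwa [Function.update_of_ne (Finset.ne_of_mem_erase hs₁),
      Function.update_of_ne (Finset.ne_of_mem_erase hs₂)]
  · push Not at hpair
    obtain ⟨u, huU, huv, hiu, hiv⟩ : ∃ u ∈ U, u ≠ v ∧ inc i u ∧ inc i v := by
      by_cases h1 : t₁ = v
      · exact ⟨t₂, h₂, fun h => hne (h1.trans h.symm), hi₂, h1 ▸ hi₁⟩
      · refine ⟨t₁, h₁, h1, hi₁, ?_⟩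
        by_cases h2 : t₂ = v
        · exact h2 ▸ hi₂
        · exact absurd hi₂ (hpair t₁ (by simp [*]) t₂ (by simp [*]) hne hi₁)
    have hadj : (pairGraph inc U).Adj v u := by
      refine ⟨huv.symm, hvU, huU, i, fun x hx => ⟨fun hix => ?_, ?_⟩⟩
      · by_contra! hxx
        exact hpair x (by simp [*]) u (by simp [*]) hxx.2 hix hiu
      · rintro (rfl | rfl) <;> assumption
    refine ⟨v, hvU, u, huU, hiv, hiu, ?_⟩
    rw [Function.update_self, Function.update_of_ne huv, hc u hadj]
    cases c <;> simp

/-- A balanced incidence relation all of whose rows have `N` elements has an `N`-colouring in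
which every row sees every colour. -/
theorem exists_equitableColoring [Fintype I] [Fintype T] (hB : IsBalancedInc inc) {N : ℕ}
    (hN : 0 < N) (hdeg : ∀ i, {t | inc i t}.ncard = N) :
    ∃ col : T → Fin N, ∀ i c, ∃ t, inc i t ∧ col t = c := by
  classical
  have : NeZero N := ⟨hN.ne'⟩
  let row : I → Finset T := fun i => Finset.univ.filter (inc i)
  have hrow : ∀ i, (row i).card = N := fun i => by
    rw [← hdeg i, ← Set.ncard_coe_finset]; congr; ext; simp [row]
  obtain ⟨col, -, hmax⟩ := (Finset.univ : Finset (T → Fin N)).exists_max_image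
    (fun col => ∑ i, ((row i).image col).card) Finset.univ_nonempty
  refine ⟨col, ?_⟩
  by_contra! hcon
  obtain ⟨i₀, q, hq⟩ := hcon
  obtain ⟨t₁, ht₁, t₂, ht₂, hne, heq⟩ : ∃ t₁ ∈ row i₀, ∃ t₂ ∈ row i₀, t₁ ≠ t₂ ∧
      col t₁ = col t₂ := by
    refine Finset.exists_ne_map_eq_of_card_lt_of_maps_to (t := Finset.univ.erase q) ?_ ?_
    · rw [hrow, Finset.card_erase_of_mem (Finset.mem_univ _), Finset.card_univ, Fintype.card_fin]
      omega
    · intro t ht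
      simpa using hq t (by simpa [row] using ht)
  set p := col t₁ with hp
  have hpq : p ≠ q := hq t₁ (by simpa [row] using ht₁)
  obtain ⟨β, hβ⟩ := hB.exists_twoColoring (Finset.univ.filter fun t => col t = p ∨ col t = q)
  simp only [Finset.mem_filter, Finset.mem_univ, true_and] at hβ
  let col' : T → Fin N := fun t => if col t = p ∨ col t = q then (if β t then p else q) else col t
  have hcolpq : ∀ t, (col t = p ∨ col t = q) → col' t = if β t then p else q :=
    fun t ht => if_pos ht
  have hcol' : ∀ t, ¬ (col t = p ∨ col t = q) → col' t = col t := fun t ht => if_neg ht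
  have hboth : ∀ i t₁ t₂, t₁ ∈ row i → t₂ ∈ row i → t₁ ≠ t₂ → (col t₁ = p ∨ col t₁ = q) →
      (col t₂ = p ∨ col t₂ = q) →
      (row i).image col ⊆ (row i).image col' ∧ q ∈ (row i).image col' := by
    intro i t₁ t₂ h₁ h₂ hne hc₁ hc₂
    obtain ⟨s₁, hs₁, s₂, hs₂, hi₁, hi₂, hd⟩ := hβ i t₁ hc₁ t₂ hc₂ hne (by simpa [row] using h₁)
      (by simpa [row] using h₂)
    have hmem : p ∈ (row i).image col' ∧ q ∈ (row i).image col' := by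
      have e₁ := hcolpq s₁ hs₁
      have e₂ := hcolpq s₂ hs₂
      have m₁ : col' s₁ ∈ (row i).image col' := Finset.mem_image_of_mem _ (by simp [row, hi₁])
      have m₂ : col' s₂ ∈ (row i).image col' := Finset.mem_image_of_mem _ (by simp [row, hi₂])
      rw [e₁] at m₁
      rw [e₂] at m₂
      cases hb₁ : β s₁ <;> cases hb₂ : β s₂ <;> rw [hb₁] at m₁ hd <;> rw [hb₂] at m₂ hd
      · exact absurd rfl hd
      · exact ⟨m₂, m₁⟩
      · exact ⟨m₁, m₂⟩
      · exact absurd rfl hd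
    refine ⟨fun c hc => ?_, hmem.2⟩
    obtain ⟨t, ht, rfl⟩ := Finset.mem_image.1 hc
    by_cases h : col t = p ∨ col t = q
    · rcases h with h | h <;> rw [h]
      · exact hmem.1
      · exact hmem.2
    · exact Finset.mem_image.2 ⟨t, ht, hcol' t h⟩
  have hle : ∀ i, ((row i).image col).card ≤ ((row i).image col').card := by
    intro i
    by_cases h : ∃ t₁ ∈ row i, ∃ t₂ ∈ row i, t₁ ≠ t₂ ∧ (col t₁ = p ∨ col t₁ = q) ∧
      (col t₂ = p ∨ col t₂ = q)
    · obtain ⟨t₁, h₁, t₂, h₂, hne, hc₁, hc₂⟩ := h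
      exact Finset.card_le_card (hboth i t₁ t₂ h₁ h₂ hne hc₁ hc₂).1
    · push Not at h
      obtain ⟨σ, hσ⟩ : ∃ σ : Equiv.Perm (Fin N), ∀ t ∈ row i, col' t = σ (col t) := by
        by_cases h' : ∃ t ∈ row i, (col t = p ∨ col t = q) ∧ col' t ≠ col t
        · obtain ⟨t, ht, hc, hct⟩ := h'
          refine ⟨Equiv.swap p q, fun s hs => ?_⟩
          by_cases hsc : col s = p ∨ col s = q
          · obtain rfl : s = t := by
              by_contra hst
              have := h s hs t ht hst hsc
              tauto
            have e := hcolpq s hc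
            rw [e] at hct ⊢
            revert hct
            rcases hc with hc | hc <;> rw [hc] <;> cases β s <;> simp
          · rw [hcol' s hsc]
            push Not at hsc
            exact (Equiv.swap_apply_of_ne_of_ne hsc.1 hsc.2).symm
        · push Not at h'
          refine ⟨1, fun s hs => ?_⟩
          by_cases hsc : col s = p ∨ col s = q
          · simpa using h' s hs hsc
          · simpa using hcol' s hsc
      rw [Finset.image_congr (fun t ht => hσ t ht), ← Function.comp_def, ← Finset.image_image,
        Finset.card_image_of_injective _ σ.injective]
  have hlt : ((row i₀).image col).card < ((row i₀).image col').card := by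
    obtain ⟨hsub, hmem⟩ := hboth i₀ t₁ t₂ ht₁ ht₂ hne (Or.inl rfl) (Or.inl heq.symm)
    refine Finset.card_lt_card ⟨hsub, fun h => ?_⟩
    obtain ⟨t, ht, htq⟩ := Finset.mem_image.1 (h hmem)
    exact hq t (by simpa [row] using ht) htq
  have := Finset.sum_lt_sum (fun i _ => hle i) ⟨i₀, Finset.mem_univ _, hlt⟩
  exact absurd (hmax col' (Finset.mem_univ _)) (not_le.2 this)

/-- In a balanced incidence relation, the support of a perfect fractional matching contains a
perfect matching. -/
theorem exists_perfectMatching [Fintype I] [Fintype T] (hB : IsBalancedInc inc) (x : T → ℚ)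
    (hx : ∀ t, 0 ≤ x t) [∀ i, DecidablePred (inc i)]
    (hsum : ∀ i, ∑ t with inc i t, x t = 1) :
    ∃ S : Set T, (∀ t ∈ S, 0 < x t) ∧ ∀ i, ∃! t, t ∈ S ∧ inc i t := by
  classical
  obtain ⟨N, hN, n, hn⟩ : ∃ N : ℕ, 0 < N ∧ ∃ n : T → ℕ, ∀ t, (n t : ℚ) = N * x t := by
    refine ⟨∏ t, (x t).den, Finset.prod_pos fun t _ => (x t).pos,
      fun t => (∏ s ∈ Finset.univ.erase t, (x s).den) * (x t).num.toNat, fun t => ?_⟩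
    have h1 : (((x t).num.toNat : ℕ) : ℚ) = (x t).num := by
      exact_mod_cast Int.toNat_of_nonneg (Rat.num_nonneg.2 (hx t))
    rw [← Finset.mul_prod_erase _ _ (Finset.mem_univ t)]
    push_cast
    rw [h1, mul_assoc, mul_comm ((x t).den : ℚ), mul_assoc, Rat.mul_den_eq_num]
  have : NeZero N := ⟨hN.ne'⟩
  have hB' : IsBalancedInc (fun (i : I) (t : Σ t, Fin (n t)) => inc i t.1) :=
    fun k t i h3 hk h => hB k (fun a => (t a).1) i h3 hk h
  have hcard : ∀ i, (Finset.univ.filter fun t : Σ t, Fin (n t) => inc i t.1).card = N := by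
    intro i
    have : (Finset.univ.filter fun t : Σ t, Fin (n t) => inc i t.1) =
        (Finset.univ.filter (inc i)).sigma fun _ => Finset.univ := by
      ext; simp
    rw [this, Finset.card_sigma]
    have h := hsum i
    have : (((∑ t with inc i t, n t : ℕ)) : ℚ) = N := by
      push_cast
      rw [Finset.sum_congr rfl fun t _ => hn t, ← Finset.mul_sum, h, mul_one]
    simpa using (by exact_mod_cast this : ∑ t with inc i t, n t = N)
  obtain ⟨col, hcol⟩ := hB'.exists_equitableColoring hN (fun i => by
    rw [← hcard i, ← Set.ncard_coe_finset]; congr; ext; simp)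
  have hinj : ∀ i, Set.InjOn col
      (Finset.univ.filter fun t : Σ t, Fin (n t) => inc i t.1 : Finset _) := by
    intro i
    refine Finset.injOn_of_surjOn_of_card_le (t := Finset.univ) col (fun _ _ => by simp) ?_ ?_
    · intro c _
      obtain ⟨t, ht, hc⟩ := hcol i c
      exact ⟨t, by simpa using ht, hc⟩
    · rw [hcard]; simp
  refine ⟨{t | ∃ c, col ⟨t, c⟩ = 0}, ?_, fun i => ?_⟩
  · rintro t ⟨c, -⟩
    have h0 : (0 : ℚ) < n t := by exact_mod_cast c.pos
    rw [hn] at h0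
    exact pos_of_mul_pos_right h0 (by positivity)
  · obtain ⟨⟨t, c⟩, ht, hc⟩ := hcol i 0
    refine ⟨t, ⟨⟨c, hc⟩, ht⟩, ?_⟩
    rintro s ⟨⟨d, hd⟩, hs⟩
    have := hinj i (x₁ := ⟨s, d⟩) (by simpa using hs) (x₂ := ⟨t, c⟩) (by simpa using ht)
      (hd.trans hc.symm)
    exact congrArg Sigma.fst this

end IsBalancedInc

/-- A set `D` of columns is dominating if every column is, in some row's ranking, at most every
element of `D`. -/
def IsDominating {I J : Type*} (r : I → J → ℕ) (D : Finset J) : Prop :=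
  ∀ k, ∃ i, ∀ j ∈ D, r i k ≤ r i j

namespace IsDominating

variable {I J : Type*} {r : I → J → ℕ}

lemma mono {R D : Finset J} (hD : IsDominating r D) (h : R ⊆ D) : IsDominating r R :=
  fun k => (hD k).imp fun _ hi j hj => hi j (h hj)

variable [Fintype I] [Fintype J]

open scoped Classical in
theorem even_card_superset (hr : ∀ i, Function.Injective (r i)) {s : I → J}
    (htop : ∀ i i' j, i ≠ i' → j ∉ Set.range s → r i j < r i (s i'))
    {R : Finset J} (hR : R.card + 1 = Fintype.card I) {e : J} (heR : e ∈ R)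
    (he : e ∉ Set.range s) :
    Even (Finset.univ.filter fun D : Finset J =>
      D.card = Fintype.card I ∧ IsDominating r D ∧ R ⊆ D).card := by
  by_cases hdom : IsDominating r R
  swap
  · rw [Finset.filter_false_of_mem fun D _ h => hdom (h.2.1.mono h.2.2)]
    simp
  choose g hgR hgmin using fun i => R.exists_min_image (r i) ⟨e, heR⟩
  have hsurj : ∀ j ∈ R, ∃ i, g i = j := fun j hj => by
    obtain ⟨i, hi⟩ := hdom j
    exact ⟨i, hr i (le_antisymm (hgmin i j hj) (hi _ (hgR i)))⟩
  let free : I → Prop := fun i => ∀ j ∈ R, ∃ i' ≠ i, g i' = j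
  have hinj : ∀ i, free i → Set.InjOn g (Finset.univ.erase i : Finset I) := by
    intro i hi
    refine Finset.injOn_of_surjOn_of_card_le (t := R) g (fun _ _ => hgR _) ?_ ?_
    · intro j hj
      obtain ⟨i', hi', rfl⟩ := hi j hj
      exact ⟨i', by simpa using hi', rfl⟩
    · rw [Finset.card_erase_of_mem (Finset.mem_univ _), Finset.card_univ]
      omega
  have hcard : (Finset.univ.filter free).card = 2 := by
    obtain ⟨i₁, -, i₂, -, hne, heq⟩ := Finset.exists_ne_map_eq_of_card_lt_of_maps_to
      (s := Finset.univ) (t := R) (f := g) (by rw [Finset.card_univ]; omega) (fun _ _ => hgR _)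
    rw [Finset.card_eq_two]
    refine ⟨i₁, i₂, hne, ?_⟩
    ext i
    simp only [Finset.mem_filter, Finset.mem_univ, true_and, Finset.mem_insert,
      Finset.mem_singleton]
    constructor
    · intro hi
      by_contra! h
      exact hne (hinj i hi (by simpa using h.1.symm) (by simpa using h.2.symm) heq)
    · rintro (rfl | rfl) <;> intro j hj <;> obtain ⟨i', rfl⟩ := hsurj j hj
      · by_cases h : i' = i
        · exact ⟨i₂, hne.symm, by rw [h, heq]⟩
        · exact ⟨i', h, rfl⟩
      · by_cases h : i' = i
        · exact ⟨i₁, hne, by rw [h, heq]⟩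
        · exact ⟨i', h, rfl⟩
  have hex : ∀ i, ∃ k, (∀ i' ≠ i, r i' (g i') < r i' k) ∧
      ∀ k', (∀ i' ≠ i, r i' (g i') < r i' k') → r i k' ≤ r i k := by
    intro i
    obtain ⟨k, hk, hmax⟩ := (Finset.univ.filter fun k =>
      ∀ i' ≠ i, r i' (g i') < r i' k).exists_max_image (r i) ⟨s i, by
        simp only [Finset.mem_filter, Finset.mem_univ, true_and]
        exact fun i' hi' => (hgmin i' e heR).trans_lt (htop i' i e hi' he)⟩
    simp only [Finset.mem_filter, Finset.mem_univ, true_and] at hk hmax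
    exact ⟨k, hk, hmax⟩
  choose κ hκ hκmax using hex
  have hκR : ∀ i, free i → κ i ∉ R := by
    intro i hi hmem
    obtain ⟨i', hi', h⟩ := hi _ hmem
    have := hκ i i' hi'
    rw [h] at this
    exact lt_irrefl _ this
  have hinjκ : Set.InjOn (fun i => insert (κ i) R) (Finset.univ.filter free : Finset I) := by
    intro i hi i' hi' h
    simp only [Finset.coe_filter, Finset.mem_univ, true_and, Set.mem_ofPred_eq] at hi hi'
    change insert (κ i) R = insert (κ i') R at h
    by_contra hne
    have hk : κ i = κ i' := by
      have : κ i ∈ insert (κ i') R := by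
        rw [← h]; exact Finset.mem_insert_self _ _
      exact (Finset.mem_insert.1 this).resolve_right (hκR i hi)
    obtain ⟨i'', h''⟩ := hdom (κ i)
    have h1 := h'' _ (hgR i'')
    by_cases hii : i'' = i
    · have := hκ i' i'' (hii ▸ hne)
      rw [← hk] at this
      omega
    · have := hκ i i'' hii
      omega
  have himg : (Finset.univ.filter fun D : Finset J =>
      D.card = Fintype.card I ∧ IsDominating r D ∧ R ⊆ D) =
      (Finset.univ.filter free).image fun i => insert (κ i) R := by
    ext D
    simp only [Finset.mem_filter, Finset.mem_univ, true_and, Finset.mem_image]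
    constructor
    · rintro ⟨hDcard, hD, hRD⟩
      obtain ⟨k, hkR, rfl⟩ : ∃ k, k ∉ R ∧ insert k R = D := by
        obtain ⟨k, hk⟩ := Finset.card_eq_one.1 (show (D \ R).card = 1 by
          rw [Finset.card_sdiff_of_subset hRD]; omega)
        have hk' : k ∈ D \ R := by simp [hk]
        refine ⟨k, (Finset.mem_sdiff.1 hk').2, ?_⟩
        rw [Finset.insert_eq, ← hk, Finset.sdiff_union_of_subset hRD]
      obtain ⟨i, hi⟩ := hD k
      have hfr : ∀ j ∈ R, ∃ i' ≠ i, g i' = j ∧ r i' j < r i' k := by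
        intro j hj
        obtain ⟨i', hi'⟩ := hD j
        have hlt : r i' j < r i' k := lt_of_le_of_ne (hi' k (Finset.mem_insert_self _ _))
          fun h => hkR (hr i' h ▸ hj)
        refine ⟨i', ?_, hr i' (le_antisymm (hgmin i' j hj)
          (hi' _ (Finset.mem_insert_of_mem (hgR i')))), hlt⟩
        rintro rfl
        exact absurd (hi j (Finset.mem_insert_of_mem hj)) (not_le.2 hlt)
      have hif : free i := fun j hj => by
        obtain ⟨i', h1, h2, -⟩ := hfr j hj
        exact ⟨i', h1, h2⟩
      have hkM : ∀ i' ≠ i, r i' (g i') < r i' k := by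
        intro i' hi'
        obtain ⟨i'', h1, h2, h3⟩ := hfr (g i') (hgR i')
        obtain rfl := hinj i hif (by simpa using h1) (by simpa using hi') h2
        exact h3
      refine ⟨i, hif, ?_⟩
      congr 1
      refine hr i (le_antisymm ?_ (hκmax i k hkM))
      obtain ⟨i', hi'⟩ := hD (κ i)
      by_cases hii : i' = i
      · subst hii
        exact hi' k (Finset.mem_insert_self _ _)
      · exact absurd (hi' _ (Finset.mem_insert_of_mem (hgR i'))) (not_le.2 (hκ i i' hii))
    · rintro ⟨i, hi, rfl⟩
      refine ⟨by rw [Finset.card_insert_of_notMem (hκR i hi), hR], fun k' => ?_,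
        Finset.subset_insert _ _⟩
      by_cases hk' : ∀ i' ≠ i, r i' (g i') < r i' k'
      · obtain ⟨i'', hi''⟩ := hdom k'
        obtain rfl : i'' = i := by
          by_contra h
          exact absurd (hi'' _ (hgR i'')) (not_le.2 (hk' i'' h))
        exact ⟨i'', fun j hj => (Finset.mem_insert.1 hj).elim (fun h => h ▸ hκmax i'' k' hk')
          (hi'' j)⟩
      · push Not at hk'
        obtain ⟨i', hi', hle⟩ := hk'
        refine ⟨i', fun j hj => hle.trans ?_⟩
        rcases Finset.mem_insert.1 hj with rfl | hj
        · exact (hκ i i' hi').le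
        · exact hgmin i' j hj
  rw [himg, Finset.card_image_of_injOn hinjκ, hcard]
  exact even_two

open scoped Classical in
theorem card_superset_eq_one (hr : ∀ i, Function.Injective (r i)) {s : I → J}
    (hs : Function.Injective s) (hbot : ∀ i j, r i (s i) ≤ r i j)
    (htop : ∀ i i' j, i ≠ i' → j ∉ Set.range s → r i j < r i (s i')) (i₀ : I) :
    (Finset.univ.filter fun D : Finset J => D.card = Fintype.card I ∧ IsDominating r D ∧
      (Finset.univ.erase i₀).image s ⊆ D).card = 1 := by
  set R := (Finset.univ.erase i₀).image s with hRdef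
  have hR : R.card + 1 = Fintype.card I := by
    rw [Finset.card_image_of_injective _ hs, Finset.card_erase_add_one (Finset.mem_univ _),
      Finset.card_univ]
  have hmemR : ∀ i, i ≠ i₀ → s i ∈ R := fun i hi =>
    Finset.mem_image_of_mem _ (by simpa using hi)
  have hs₀ : s i₀ ∉ R := by simp [hRdef, hs.eq_iff]
  obtain ⟨k, hkR, hmax⟩ := (Finset.univ.filter (· ∉ R)).exists_max_image (r i₀)
    ⟨s i₀, by simpa using hs₀⟩
  simp only [Finset.mem_filter, Finset.mem_univ, true_and] at hkR hmax
  rw [Finset.card_eq_one]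
  refine ⟨insert k R, ?_⟩
  ext D
  simp only [Finset.mem_filter, Finset.mem_univ, true_and, Finset.mem_singleton]
  constructor
  · rintro ⟨hDcard, hD, hRD⟩
    obtain ⟨i, hi⟩ := hD k
    obtain ⟨l, hlR, rfl⟩ : ∃ l, l ∉ R ∧ insert l R = D := by
      obtain ⟨l, hl⟩ := Finset.card_eq_one.1 (show (D \ R).card = 1 by
        rw [Finset.card_sdiff_of_subset hRD]; omega)
      have hl' : l ∈ D \ R := by simp [hl]
      refine ⟨l, (Finset.mem_sdiff.1 hl').2, ?_⟩
      rw [Finset.insert_eq, ← hl, Finset.sdiff_union_of_subset hRD]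
    obtain rfl : i = i₀ := by
      by_contra h
      have h1 := hi (s i) (Finset.mem_insert_of_mem (hmemR i h))
      have h2 := hr i (le_antisymm h1 (hbot i k))
      exact hkR (h2 ▸ hmemR i h)
    rw [hr i (le_antisymm (hmax l hlR) (hi l (Finset.mem_insert_self _ _)))]
  · rintro rfl
    refine ⟨by rw [Finset.card_insert_of_notMem hkR, hR], fun k' => ?_,
      Finset.subset_insert _ _⟩
    by_cases hk' : k' ∈ R
    · obtain ⟨i, -, rfl⟩ := Finset.mem_image.1 hk'
      exact ⟨i, fun j _ => hbot i j⟩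
    · refine ⟨i₀, fun j hj => ?_⟩
      rcases Finset.mem_insert.1 hj with rfl | hj
      · exact hmax k' hk'
      · obtain ⟨i, hi, rfl⟩ := Finset.mem_image.1 hj
        have hi : i ≠ i₀ := by simpa using hi
        by_cases hks : k' ∈ Set.range s
        · obtain ⟨i', rfl⟩ := hks
          obtain rfl : i' = i₀ := by
            by_contra h
            exact hk' (hmemR i' h)
          exact hbot _ _
        · exact (htop i₀ i k' hi.symm hks).le

end IsDominating

/-- The right-hand side `b` is generic if no solution of `L x = b` has support smaller than the
number of rows. -/
def IsGeneric {I J : Type*} [Fintype I] (L : (J → ℚ) →ₗ[ℚ] I → ℚ) (b : I → ℚ) : Prop :=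
  ∀ S : Finset J, S.card < Fintype.card I → ∀ x, (∀ j ∉ S, x j = 0) → L x ≠ b

/-- The set `B` of columns is feasible if it supports a nonnegative solution of `L x = b`. -/
def IsFeasible {I J : Type*} (L : (J → ℚ) →ₗ[ℚ] I → ℚ) (b : I → ℚ) (B : Finset J) : Prop :=
  ∃ x, (∀ j, 0 ≤ x j) ∧ (∀ j ∉ B, x j = 0) ∧ L x = b

namespace IsGeneric

variable {I J : Type*} [Fintype I] {L : (J → ℚ) →ₗ[ℚ] I → ℚ} {b : I → ℚ}

lemma eq_zero_of_map_eq_zero (hb : IsGeneric L b) {B : Finset J}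
    (hB : B.card ≤ Fintype.card I) {x z : J → ℚ} (hx : ∀ j ∉ B, x j = 0) (hLx : L x = b)
    (hz : ∀ j ∉ B, z j = 0) (hLz : L z = 0) : z = 0 := by
  classical
  by_contra hne
  obtain ⟨k, hk⟩ := Function.ne_iff.1 hne
  have hk : z k ≠ 0 := hk
  have hkB : k ∈ B := by
    by_contra h
    exact hk (hz k h)
  refine hb (B.erase k) (lt_of_lt_of_le (Finset.card_erase_lt_of_mem hkB) hB)
    (x - (x k / z k) • z) (fun j hj => ?_) (by simp [hLx, hLz])
  by_cases hjk : j = k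
  · subst hjk
    simp [hk]
  · have hjB : j ∉ B := fun h => hj (by simp [hjk, h])
    simp [hx j hjB, hz j hjB]

lemma pos_of_mem (hb : IsGeneric L b) {B : Finset J} (hB : B.card = Fintype.card I)
    {x : J → ℚ} (hx0 : ∀ j, 0 ≤ x j) (hx : ∀ j ∉ B, x j = 0) (hLx : L x = b) {j : J}
    (hj : j ∈ B) : 0 < x j := by
  classical
  refine lt_of_le_of_ne (hx0 j) fun h => ?_
  refine hb (B.erase j) (hB ▸ Finset.card_erase_lt_of_mem hj) x (fun k hk => ?_) hLx
  by_cases hkj : k = j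
  · exact hkj ▸ h.symm
  · exact hx k fun h => hk (by simp [hkj, h])

lemma exists_ker (L : (J → ℚ) →ₗ[ℚ] I → ℚ) {S : Finset J} (hS : Fintype.card I < S.card) :
    ∃ z, z ≠ 0 ∧ (∀ j ∉ S, z j = 0) ∧ L z = 0 := by
  have h := LinearMap.ker_ne_bot_of_finrank_lt
    (f := L ∘ₗ Function.ExtendByZero.linearMap ℚ (Subtype.val : S → J)) (by simpa using hS)
  obtain ⟨w, hw, hne⟩ := (Submodule.ne_bot_iff _).1 h
  refine ⟨Function.ExtendByZero.linearMap ℚ (Subtype.val : S → J) w, fun h0 => hne ?_,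
    fun j hj => ?_, hw⟩
  · ext j
    have := congrFun h0 j
    rwa [Function.ExtendByZero.linearMap_apply, Subtype.val_injective.extend_apply] at this
  · simp only [Function.ExtendByZero.linearMap_apply]
    exact Function.extend_apply' _ _ _ fun ⟨a, ha⟩ => hj (ha ▸ a.2)

open scoped Classical in
/-- For a generic right-hand side of a bounded system, the number of feasible bases among the
columns of a set with one element too many is even. -/
theorem even_card_feasible (hb : IsGeneric L b)
    (hpos : ∀ z : J → ℚ, (∀ j, 0 ≤ z j) → L z = 0 → z = 0) {T : Finset J}
    (hT : T.card = Fintype.card I + 1) :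
    Even ((T.powersetCard (Fintype.card I)).filter (IsFeasible L b)).card := by
  by_cases hne : ((T.powersetCard (Fintype.card I)).filter (IsFeasible L b)).Nonempty
  swap
  · rw [Finset.not_nonempty_iff_eq_empty.1 hne]
    simp
  have herase : ∀ B ∈ (T.powersetCard (Fintype.card I)).filter (IsFeasible L b),
      ∃ k ∈ T, B = T.erase k := by
    intro B hB
    obtain ⟨hBT, hBc⟩ := Finset.mem_powersetCard.1 (Finset.mem_filter.1 hB).1
    obtain ⟨k, hk⟩ := Finset.card_eq_one.1 (show (T \ B).card = 1 by
      rw [Finset.card_sdiff_of_subset hBT]; omega)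
    have hk' : k ∈ T \ B := by simp [hk]
    refine ⟨k, (Finset.mem_sdiff.1 hk').1, ?_⟩
    rw [← Finset.sdiff_singleton_eq_erase, ← hk, Finset.sdiff_sdiff_eq_self hBT]
  obtain ⟨B₀, hB₀⟩ := hne
  obtain ⟨k₀, hk₀, rfl⟩ := herase B₀ hB₀
  have hcard : ∀ k ∈ T, (T.erase k).card = Fintype.card I := fun k hk => by
    rw [Finset.card_erase_of_mem hk, hT]; rfl
  obtain ⟨x, hx0, hx, hLx⟩ := (Finset.mem_filter.1 hB₀).2
  have hxpos : ∀ j ∈ T, j ≠ k₀ → 0 < x j := fun j hj hjk =>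
    hb.pos_of_mem (hcard _ hk₀) hx0 hx hLx (by simp [hj, hjk])
  have hxk₀ : x k₀ = 0 := hx _ (by simp)
  obtain ⟨z, hzk₀, hz, hLz⟩ : ∃ z : J → ℚ, z k₀ = 1 ∧ (∀ j ∉ T, z j = 0) ∧ L z = 0 := by
    obtain ⟨z, hz0, hz, hLz⟩ := exists_ker L (S := T) (by omega)
    have hzk : z k₀ ≠ 0 := fun h => hz0 <| hb.eq_zero_of_map_eq_zero (hcard _ hk₀).le hx hLx
      (fun j hj => by
        by_cases hjk : j = k₀
        · exact hjk ▸ h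
        · exact hz j fun hjT => hj (by simp [hjk, hjT])) hLz
    exact ⟨(z k₀)⁻¹ • z, by simp [hzk], fun j hj => by simp [hz j hj], by simp [hLz]⟩
  obtain ⟨j₁, hj₁, hmin⟩ := (T.filter fun j => z j < 0).exists_min_image
    (fun j => x j / -z j) (by
      by_contra hemp
      rw [Finset.not_nonempty_iff_eq_empty, Finset.filter_eq_empty_iff] at hemp
      have : z = 0 := hpos z (fun j => by
        by_cases hj : j ∈ T
        · exact not_lt.1 (hemp hj)
        · exact (hz j hj).ge) hLz
      rw [this] at hzk₀
      simp at hzk₀)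
  simp only [Finset.mem_filter] at hj₁ hmin
  obtain ⟨hj₁T, hj₁z⟩ := hj₁
  have hj₁k : j₁ ≠ k₀ := by
    rintro rfl
    rw [hzk₀] at hj₁z
    norm_num at hj₁z
  set t := x j₁ / -z j₁ with ht
  have htpos : 0 < t := div_pos (hxpos _ hj₁T hj₁k) (by linarith)
  have hy0 : ∀ j, 0 ≤ (x + t • z) j := by
    intro j
    simp only [Pi.add_apply, Pi.smul_apply, smul_eq_mul]
    by_cases hj : j ∈ T ∧ z j < 0
    · have := hmin j hj
      rw [le_div_iff₀ (by linarith [hj.2])] at this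
      linarith
    · have hzj : 0 ≤ z j := by
        by_cases hjT : j ∈ T
        · exact not_lt.1 fun h => hj ⟨hjT, h⟩
        · exact (hz j hjT).ge
      have := hx0 j
      positivity
  have hyj₁ : (x + t • z) j₁ = 0 := by
    simp only [Pi.add_apply, Pi.smul_apply, smul_eq_mul, ht]
    have := hj₁z.ne
    field_simp
    ring
  have hyT : ∀ j ∉ T.erase j₁, (x + t • z) j = 0 := by
    intro j hj
    by_cases hjj : j = j₁
    · rw [hjj, hyj₁]
    · have hjT : j ∉ T := fun h => hj (by simp [hjj, h])
      simp [hx j (fun h => hjT (Finset.mem_of_mem_erase h)), hz j hjT]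
  have hLy : L (x + t • z) = b := by simp [hLx, hLz]
  have hfeas : (T.powersetCard (Fintype.card I)).filter (IsFeasible L b) =
      {T.erase k₀, T.erase j₁} := by
    ext B
    rw [Finset.mem_insert, Finset.mem_singleton]
    constructor
    · intro hB
      obtain ⟨k', hk', rfl⟩ := herase B hB
      obtain ⟨x', hx'0, hx', hLx'⟩ := (Finset.mem_filter.1 hB).2
      have hxk : x' k' = 0 := hx' _ (by simp)
      have hdiff : x' - x - x' k₀ • z = 0 := by
        refine hb.eq_zero_of_map_eq_zero (hcard _ hk₀).le hx hLx (fun j hj => ?_)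
          (by simp [hLx, hLx', hLz])
        by_cases hjk : j = k₀
        · subst hjk
          simp [hzk₀, hxk₀]
        · have hjT : j ∉ T := fun h => hj (by simp [hjk, h])
          simp [hx j hj, hz j hjT, hx' j (fun h => hjT (Finset.mem_of_mem_erase h))]
      have hxeq : ∀ j, x' j = x j + x' k₀ * z j := fun j => by
        have := congrFun hdiff j
        simp only [Pi.sub_apply, Pi.smul_apply, smul_eq_mul, Pi.zero_apply] at this
        linarith
      by_cases hkk : k' = k₀
      · exact Or.inl (by rw [hkk])
      · right
        have hxk' := hxpos k' hk' hkk
        have hs : 0 ≤ x' k₀ := hx'0 k₀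
        have e := hxeq k'
        rw [hxk] at e
        have hzk' : z k' < 0 := by
          by_contra! h
          have := mul_nonneg hs h
          linarith
        have h1 : t ≤ x' k₀ := by
          refine (hmin k' ⟨hk', hzk'⟩).trans (le_of_eq ?_)
          rw [div_eq_iff (by linarith)]
          linarith
        have h2 : x' k₀ ≤ t := by
          rw [ht, le_div_iff₀ (by linarith)]
          have := hx'0 j₁
          rw [hxeq] at this
          linarith
        have h3 : x' j₁ = 0 := by
          rw [hxeq, le_antisymm h2 h1, ← hyj₁]
          rfl
        by_contra hne
        have hj : j₁ ∈ T.erase k' := by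
          refine Finset.mem_erase.2 ⟨?_, hj₁T⟩
          rintro rfl
          exact hne rfl
        exact (hb.pos_of_mem (hcard _ hk') hx'0 hx' hLx' hj).ne' h3
    · rintro (rfl | rfl)
      · exact hB₀
      · exact Finset.mem_filter.2 ⟨Finset.mem_powersetCard.2 ⟨Finset.erase_subset _ _,
          hcard _ hj₁T⟩, _, hy0, hyT, hLy⟩
  rw [hfeas, Finset.card_pair]
  · exact even_two
  · intro h
    have : k₀ ∈ T.erase j₁ := Finset.mem_erase.2 ⟨hj₁k.symm, hk₀⟩
    rw [← h] at this
    simp at this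

end IsGeneric

section Scarf

variable {I J : Type*} [Fintype I] [Fintype J]

/-- Scarf's lemma for a generic right-hand side and strict rankings. -/
theorem exists_feasible_dominating_of_isGeneric [Nonempty I] {L : (J → ℚ) →ₗ[ℚ] I → ℚ}
    {b : I → ℚ} {r : I → J → ℕ} {s : I → J} {hs : Function.Injective s} (hb : IsGeneric L b)
    (hpos : ∀ z : J → ℚ, (∀ j, 0 ≤ z j) → L z = 0 → z = 0)
    (hslack : IsFeasible L b (Finset.univ.map ⟨s, hs⟩))
    (hr : ∀ i, Function.Injective (r i)) (hbot : ∀ i j, r i (s i) ≤ r i j)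
    (htop : ∀ i i' j, i ≠ i' → j ∉ Set.range s → r i j < r i (s i')) :
    ∃ B : Finset J, B.card = Fintype.card I ∧ IsDominating r B ∧ IsFeasible L b B := by
  classical
  by_contra! hcon
  obtain ⟨i₀⟩ := ‹Nonempty I›
  set m := Fintype.card I with hm
  let 𝓑 : Finset (Finset J) :=
    Finset.univ.filter fun B => B.card = m ∧ IsFeasible L b B ∧ s i₀ ∈ B
  let 𝓓 : Finset (Finset J) :=
    Finset.univ.filter fun D => D.card = m ∧ IsDominating r D ∧ s i₀ ∉ D
  let rel : Finset J → Finset J → Prop := fun B D => B ⊆ insert (s i₀) D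
  have hcount := Finset.sum_card_bipartiteAbove_eq_sum_card_bipartiteBelow
    (s := 𝓑) (t := 𝓓) rel
  have hD : ∀ D ∈ 𝓓, Even (𝓑.bipartiteBelow rel D).card := by
    intro D hD
    obtain ⟨hDc, hDd, hDs⟩ := (Finset.mem_filter.1 hD).2
    have := hb.even_card_feasible hpos (T := insert (s i₀) D)
      (by rw [Finset.card_insert_of_notMem hDs, hDc])
    convert this using 2
    ext B
    simp only [Finset.bipartiteBelow, 𝓑, rel, Finset.mem_filter, Finset.mem_univ, true_and,
      Finset.mem_powersetCard]
    constructor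
    · rintro ⟨⟨h1, h2, -⟩, h3⟩
      exact ⟨⟨h3, h1⟩, h2⟩
    · rintro ⟨⟨h3, h1⟩, h2⟩
      refine ⟨⟨h1, h2, ?_⟩, h3⟩
      by_contra hsB
      have hBD : B ⊆ D := fun j hj => (Finset.mem_insert.1 (h3 hj)).resolve_left
        fun h => hsB (h ▸ hj)
      obtain rfl := Finset.eq_of_subset_of_card_le hBD (by omega)
      exact hcon B h1 hDd h2
  have habove : ∀ B ∈ 𝓑, 𝓓.bipartiteAbove rel B = Finset.univ.filter fun D : Finset J =>
      D.card = m ∧ IsDominating r D ∧ B.erase (s i₀) ⊆ D := by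
    intro B hB
    obtain ⟨hBc, hBf, hBs⟩ := (Finset.mem_filter.1 hB).2
    ext D
    simp only [Finset.bipartiteAbove, 𝓓, rel, Finset.mem_filter, Finset.mem_univ, true_and,
      ← Finset.subset_insert_iff]
    constructor
    · rintro ⟨⟨h1, h2, -⟩, h3⟩
      exact ⟨h1, h2, h3⟩
    · rintro ⟨h1, h2, h3⟩
      refine ⟨⟨h1, h2, fun hsD => ?_⟩, h3⟩
      rw [Finset.insert_eq_of_mem hsD] at h3
      obtain rfl := Finset.eq_of_subset_of_card_le h3 (by omega)
      exact hcon B h1 h2 hBf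
  set B₀ := Finset.univ.map ⟨s, hs⟩ with hB₀
  have hB₀c : B₀.card = m := by rw [hB₀, Finset.card_map, Finset.card_univ]
  have hB₀mem : B₀ ∈ 𝓑 := Finset.mem_filter.2
    ⟨Finset.mem_univ _, hB₀c, hslack, by simp [hB₀]⟩
  have hodd : (𝓓.bipartiteAbove rel B₀).card = 1 := by
    rw [habove B₀ hB₀mem]
    have := IsDominating.card_superset_eq_one hr hs hbot htop i₀
    convert this using 6
    ext j
    simp only [hB₀, Finset.mem_erase, Finset.mem_map, Finset.mem_univ, true_and,
      Function.Embedding.coeFn_mk, Finset.mem_image, and_true]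
    constructor
    · rintro ⟨h, i, rfl⟩
      exact ⟨i, fun h' => h (by rw [h']), rfl⟩
    · rintro ⟨i, h, rfl⟩
      exact ⟨fun h' => h (hs h'), i, rfl⟩
  have heven : ∀ B ∈ 𝓑.erase B₀, Even (𝓓.bipartiteAbove rel B).card := by
    intro B hB
    obtain ⟨hne, hB⟩ := Finset.mem_erase.1 hB
    rw [habove B hB]
    obtain ⟨hBc, hBf, hBs⟩ := (Finset.mem_filter.1 hB).2
    obtain ⟨e, heB, he⟩ : ∃ e ∈ B, e ∉ Set.range s := by
      by_contra! h
      refine hne (Finset.eq_of_subset_of_card_le (fun j hj => ?_) (by omega))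
      obtain ⟨i, rfl⟩ := h j hj
      simp [hB₀]
    exact IsDominating.even_card_superset hr htop (R := B.erase (s i₀))
      (by rw [Finset.card_erase_add_one hBs, hBc])
      (Finset.mem_erase.2 ⟨fun h => he ⟨i₀, h.symm⟩, heB⟩) he
  rw [← Finset.add_sum_erase _ _ hB₀mem, hodd] at hcount
  have h1 := Finset.even_sum _ heven
  have h2 := Finset.even_sum _ hD
  rw [← hcount, Nat.even_add] at h2
  exact Nat.not_even_one (h2.2 h1)

/-- Perturbing a right-hand side in a suitable direction makes it generic. -/
theorem exists_eventually_isGeneric (L : (J → ℚ) →ₗ[ℚ] I → ℚ) (b : I → ℚ) :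
    ∃ v : I → ℚ, ∀ᶠ ε : ℚ in nhdsWithin 0 (Set.Ioi 0), IsGeneric L (b + ε • v) := by
  classical
  let U : Finset J → Submodule ℚ (I → ℚ) := fun S =>
    Submodule.span ℚ ((S.image fun j => L (Pi.single j 1) : Finset _) : Set (I → ℚ))
  have hU : ∀ S x, (∀ j ∉ S, x j = 0) → L x ∈ U S := by
    intro S x hx
    rw [LinearMap.pi_apply_eq_sum_univ]
    refine Submodule.sum_mem _ fun j _ => ?_
    by_cases hj : j ∈ S
    · refine Submodule.smul_mem _ _ (Submodule.subset_span ?_)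
      refine Finset.mem_coe.2 (Finset.mem_image.2 ⟨j, hj, ?_⟩)
      congr 1
      ext k
      simp [Pi.single_apply, eq_comm]
    · simp [hx j hj]
  have hUtop : ∀ S : {S : Finset J // S.card < Fintype.card I}, U S ≠ ⊤ := by
    rintro ⟨S, hS⟩ h
    have h1 := finrank_span_finset_le_card (R := ℚ) (S.image fun j => L (Pi.single j 1))
    have h2 : Module.finrank ℚ (U S) = Fintype.card I := by
      rw [h, finrank_top, Module.finrank_pi]
    have h3 := Finset.card_image_le (s := S) (f := fun j => L (Pi.single j 1))
    rw [Set.finrank] at h1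
    have h4 : Module.finrank ℚ (U S) ≤ _ := h1
    omega
  obtain ⟨v, hv⟩ := Submodule.exists_forall_notMem_of_forall_ne_top _ hUtop
  refine ⟨v, ?_⟩
  have hev : ∀ S : {S : Finset J // S.card < Fintype.card I},
      ∀ᶠ ε : ℚ in nhdsWithin 0 (Set.Ioi 0), b + ε • v ∉ U S := by
    intro S
    by_cases h : ∃ ε₀ : ℚ, 0 < ε₀ ∧ b + ε₀ • v ∈ U S
    · obtain ⟨ε₀, hε₀, hmem⟩ := h
      filter_upwards [Ioo_mem_nhdsGT hε₀] with ε hε hmem'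
      have h1 := Submodule.sub_mem _ hmem hmem'
      rw [add_sub_add_left_eq_sub, ← sub_smul] at h1
      exact hv S ((Submodule.smul_mem_iff _ (sub_pos.2 hε.2).ne').1 h1)
    · push Not at h
      filter_upwards [self_mem_nhdsWithin] with ε hε using h ε hε
  filter_upwards [Filter.eventually_all.2 hev] with ε hε S hS x hx hLx
  exact hε ⟨S, hS⟩ (hLx ▸ hU S x hx)

/-- If suitably small generic perturbations of `b` in a direction are feasible for sets of columns
with property `P`, then so is `b`. -/
theorem IsFeasible.of_eventually {L : (J → ℚ) →ₗ[ℚ] I → ℚ} {b v : I → ℚ}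
    {P : Finset J → Prop}
    (h : ∀ᶠ ε : ℚ in nhdsWithin 0 (Set.Ioi 0), IsGeneric L (b + ε • v) ∧
      ∃ B : Finset J, B.card = Fintype.card I ∧ P B ∧ IsFeasible L (b + ε • v) B) :
    ∃ B : Finset J, P B ∧ IsFeasible L b B := by
  classical
  obtain ⟨B, hB⟩ : ∃ B : Finset J, ∃ᶠ ε : ℚ in nhdsWithin 0 (Set.Ioi 0),
      IsGeneric L (b + ε • v) ∧ B.card = Fintype.card I ∧ P B ∧
        IsFeasible L (b + ε • v) B := by
    by_contra hcon
    simp only [not_exists, Filter.not_frequently] at hcon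
    obtain ⟨ε, ⟨hg, B, hB⟩, hn⟩ := (h.and (Filter.eventually_all.2 hcon)).exists
    exact hn B ⟨hg, hB⟩
  obtain ⟨ε₁, ⟨hg, hBc, hPB, x₁, -, hx₁, hLx₁⟩, hε₁⟩ := (hB.and_eventually
    (self_mem_nhdsWithin : ∀ᶠ ε : ℚ in nhdsWithin 0 (Set.Ioi 0), ε ∈ Set.Ioi 0)).exists
  obtain ⟨ε₂, ⟨-, -, -, x₂, -, hx₂, hLx₂⟩, hε₂⟩ :=
    (hB.and_eventually (Ioo_mem_nhdsGT hε₁)).exists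
  have hne : ε₁ - ε₂ ≠ 0 := (sub_pos.2 hε₂.2).ne'
  let q : J → ℚ := (ε₁ - ε₂)⁻¹ • (x₁ - x₂)
  let p : J → ℚ := x₁ - ε₁ • q
  have hq : ∀ j ∉ B, q j = 0 := fun j hj => by simp [q, hx₁ j hj, hx₂ j hj]
  have hp : ∀ j ∉ B, p j = 0 := fun j hj => by simp [p, hx₁ j hj, hq j hj]
  have hLq : L q = v := by
    simp only [q, map_smul, map_sub, hLx₁, hLx₂]
    rw [add_sub_add_left_eq_sub, ← sub_smul, smul_smul, inv_mul_cancel₀ hne, one_smul]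
  have hLp : L p = b := by simp [p, hLx₁, hLq]
  refine ⟨B, hPB, p, fun j => ?_, hp, hLp⟩
  by_contra! hneg
  have hcont : Filter.Tendsto (fun ε : ℚ => p j + ε * q j) (nhdsWithin 0 (Set.Ioi 0))
      (nhds (p j + 0 * q j)) :=
    (Continuous.tendsto (by fun_prop) 0).mono_left nhdsWithin_le_nhds
  obtain ⟨ε, ⟨-, -, -, x, hx0, hx, hLx⟩, hε⟩ := (hB.and_eventually
    (hcont.eventually (gt_mem_nhds (show p j + 0 * q j < 0 by simpa using hneg)))).exists
  have hzero : x - (p + ε • q) = 0 :=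
    hg.eq_zero_of_map_eq_zero hBc.le hx₁ hLx₁ (fun k hk => by simp [hx k hk, hp k hk, hq k hk])
      (by simp [hLx, hLp, hLq])
  have := congrFun hzero j
  simp only [Pi.sub_apply, Pi.add_apply, Pi.smul_apply, smul_eq_mul, Pi.zero_apply] at this
  have := hx0 j
  linarith

end Scarf

section Hypergraph

variable {I E : Type*} [Fintype I] [Fintype E] [DecidableEq I]

/-- The incidence relation of a hypergraph with a loop added at each vertex. -/
def loopInc (A : E → Finset I) (i : I) : I ⊕ E → Prop
  | Sum.inl i' => i' = i
  | Sum.inr e => i ∈ A e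

/-- Scarf's lemma for hypergraphs: some perfect fractional matching of the hypergraph with loops
is stable with respect to given rankings of the edges by the vertices. -/
theorem exists_stable_fractional [Nonempty I] (A : E → Finset I) (hA : ∀ e, (A e).Nonempty)
    (c : I → E → ℕ) [∀ i, DecidablePred (loopInc A i)] :
    ∃ x : I ⊕ E → ℚ, (∀ j, 0 ≤ x j) ∧ (∀ i, ∑ j with loopInc A i j, x j = 1) ∧
      ∀ e, ∃ i ∈ A e, x (Sum.inl i) = 0 ∧
        ∀ e', i ∈ A e' → x (Sum.inr e') ≠ 0 → c i e ≤ c i e' := by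
  classical
  let L : (I ⊕ E → ℚ) →ₗ[ℚ] I → ℚ :=
    { toFun := fun x i => ∑ j with loopInc A i j, x j
      map_add' := fun x y => by ext i; simp [Finset.sum_add_distrib]
      map_smul' := fun a x => by ext i; simp [Finset.mul_sum] }
  have hL : ∀ x i, L x i = ∑ j with loopInc A i j, x j := fun _ _ => rfl
  have hloop : ∀ j : I ⊕ E, ∃ i, loopInc A i j := by
    rintro (i | e)
    · exact ⟨i, rfl⟩
    · exact hA e
  have hpos : ∀ z : I ⊕ E → ℚ, (∀ j, 0 ≤ z j) → L z = 0 → z = 0 := by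
    intro z hz hLz
    ext j
    obtain ⟨i, hi⟩ := hloop j
    have h := congrFun hLz i
    rw [hL, Pi.zero_apply, Finset.sum_eq_zero_iff_of_nonneg fun j _ => hz j] at h
    exact h j (by simpa using hi)
  have hsl : ∀ b : I → ℚ, (∀ i, 0 ≤ b i) →
      IsFeasible L b (Finset.univ.map ⟨Sum.inl, Sum.inl_injective⟩) := by
    intro b hb
    refine ⟨Sum.elim b 0, ?_, ?_, ?_⟩
    · rintro (i | e)
      · exact hb i
      · exact le_rfl
    · rintro (i | e) h
      · simp at h
      · rfl
    · ext i
      rw [hL, Finset.sum_eq_single (Sum.inl i)]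
      · rfl
      · rintro (i' | e) hj hne
        · have hi : i' = i := (Finset.mem_filter.1 hj).2
          exact absurd (by rw [hi]) hne
        · rfl
      · exact fun h => absurd (Finset.mem_filter.2 ⟨Finset.mem_univ _, show loopInc A i (Sum.inl i) from rfl⟩) h
  obtain ⟨M, hM⟩ : ∃ M, ∀ i e, c i e < M := by
    obtain ⟨M, hM⟩ := (Set.finite_range fun p : I × E => c p.1 p.2).bddAbove
    exact ⟨M + 1, fun i e => Nat.lt_succ_of_le (hM ⟨(i, e), rfl⟩)⟩
  let w : I → I ⊕ E → ℕ := fun i => Sum.elim (fun i' => if i' = i then 0 else M + 2)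
    (fun e => if i ∈ A e then c i e + 1 else M + 1)
  let n := Fintype.card (I ⊕ E)
  let ι := Fintype.equivFin (I ⊕ E)
  let r : I → I ⊕ E → ℕ := fun i j => w i j * n + ι j
  have hι : ∀ j, (ι j : ℕ) < n := fun j => (ι j).2
  have hrlt : ∀ i j j', w i j < w i j' → r i j < r i j' := by
    intro i j j' h
    have h1 : (w i j + 1) * n ≤ w i j' * n := Nat.mul_le_mul_right _ h
    have := hι j
    simp only [r]
    linarith
  have hwle : ∀ i j j', r i j ≤ r i j' → w i j ≤ w i j' := fun i j j' h =>
    not_lt.1 fun h' => absurd h (not_le.2 (hrlt i _ _ h'))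
  have hr : ∀ i, Function.Injective (r i) := by
    intro i j j' h
    have hw : w i j = w i j' := le_antisymm (hwle i _ _ h.le) (hwle i _ _ h.ge)
    simp only [r, hw] at h
    exact ι.injective (Fin.ext (by omega))
  have hbot : ∀ i j, r i (Sum.inl i) ≤ r i j := by
    intro i j
    by_cases h : j = Sum.inl i
    · rw [h]
    · refine (hrlt _ _ _ ?_).le
      rcases j with i' | e
      · have : i' ≠ i := fun h' => h (by rw [h'])
        simp [w, this]
      · simp only [w, Sum.elim_inl, Sum.elim_inr, if_true]
        split_ifs <;> omega
  have htop : ∀ i i' j, i ≠ i' → j ∉ Set.range (Sum.inl : I → I ⊕ E) →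
      r i j < r i (Sum.inl i') := by
    rintro i i' (i'' | e) hne hj
    · exact absurd ⟨i'', rfl⟩ hj
    · refine hrlt _ _ _ ?_
      have := hM i e
      simp only [w, Sum.elim_inl, Sum.elim_inr, if_neg hne.symm]
      split_ifs <;> omega
  obtain ⟨v, hv⟩ := exists_eventually_isGeneric L 1
  have hvpos : ∀ᶠ ε : ℚ in nhdsWithin 0 (Set.Ioi 0), ∀ i, 0 ≤ ((1 : I → ℚ) + ε • v) i := by
    refine Filter.eventually_all.2 fun i => ?_
    have hcont : Filter.Tendsto (fun ε : ℚ => 1 + ε * v i) (nhdsWithin 0 (Set.Ioi 0))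
        (nhds (1 + 0 * v i)) :=
      (Continuous.tendsto (by fun_prop) 0).mono_left nhdsWithin_le_nhds
    filter_upwards [hcont.eventually (lt_mem_nhds (a := 0) (by simp))] with ε hε
    simpa using hε.le
  obtain ⟨B, hB, x, hx0, hx, hLx⟩ := IsFeasible.of_eventually (P := IsDominating r) <| by
    filter_upwards [hv, hvpos] with ε hε hε'
    exact ⟨hε, exists_feasible_dominating_of_isGeneric hε hpos (hsl _ hε') hr hbot htop⟩
  have hsum : ∀ i, ∑ j with loopInc A i j, x j = 1 := fun i => congrFun hLx i
  refine ⟨x, hx0, hsum, fun e => ?_⟩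
  obtain ⟨i, hi⟩ := hB (Sum.inr e)
  have hi' : ∀ j, x j ≠ 0 → w i (Sum.inr e) ≤ w i j := fun j hj =>
    hwle _ _ _ (hi j (by_contra fun h => hj (hx j h)))
  have hie : i ∈ A e := by
    by_contra hie
    obtain ⟨j, hj, hxj⟩ : ∃ j, loopInc A i j ∧ x j ≠ 0 := by
      by_contra! h
      have := hsum i
      rw [Finset.sum_eq_zero fun j hj => h j (by simpa using hj)] at this
      exact zero_ne_one this
    have hwj := hi' j hxj
    rcases j with i' | e'
    · simp [w, show i' = i from hj, hie] at hwj
    · have := hM i e'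
      simp [w, show i ∈ A e' from hj, hie] at hwj
      omega
  refine ⟨i, hie, ?_, fun e' he' hxe' => ?_⟩
  · by_contra h
    simpa [w, hie] using hi' _ h
  · simpa [w, hie, he'] using hi' _ hxe'

end Hypergraph

lemma isBalancedInc_loopInc {I E : Type*} [DecidableEq I] {edges : Finset I → Prop}
    (h : ¬ HasNontrivialOddCycle edges) {A : E → Finset I} (hA : ∀ e, edges (A e)) :
    IsBalancedInc (loopInc A) := by
  intro k t i hk hodd hti
  have htwo : (2 : ZMod k) ≠ 0 := by
    intro h2
    have : ((2 : ℕ) : ZMod k) = 0 := by exact_mod_cast h2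
    rw [ZMod.natCast_eq_zero_iff] at this
    have := Nat.le_of_dvd two_pos this
    omega
  have hone : (1 : ZMod k) ≠ 0 := fun h1 => htwo (by rw [← one_add_one_eq_two, h1, add_zero])
  have hinr : ∀ a, ∃ e, t a = Sum.inr e := by
    intro a
    rcases hta : t a with i' | e
    · have h1 : loopInc A (i a) (t a) := (hti a a).2 (Or.inl rfl)
      have h2 : loopInc A (i (a - 1)) (t a) := (hti a (a - 1)).2 (Or.inr (by ring))
      rw [hta] at h1 h2
      have h3 : i a = i (a - 1) := h1.symm.trans h2
      have h4 := (hti (a + 1) a).2 (Or.inr rfl)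
      rw [h3, hti] at h4
      rcases h4 with h4 | h4
      · exact absurd (by linear_combination h4) htwo
      · exact absurd (by linear_combination h4) hone
    · exact ⟨e, rfl⟩
  choose e he using hinr
  have hmem : ∀ a b, i (b - 1) ∈ A (e a) ↔ b = a ∨ b = a + 1 := by
    intro a b
    have h1 : i (b - 1) ∈ A (e a) ↔ loopInc A (i (b - 1)) (t a) := by rw [he]; rfl
    rw [h1, hti, or_comm, sub_add_cancel]
    exact or_congr eq_comm ⟨fun h => by rw [h]; ring, fun h => by rw [h]; ring⟩
  have hswap : ∀ a b : ZMod k, b = a ∨ b = a + 1 → a = b ∨ a = b + 1 → a = b := by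
    rintro a b (rfl | h1) (h2 | h2)
    · rfl
    · rfl
    · exact h2
    · exact absurd (by linear_combination - h1 - h2) htwo
  refine h ⟨k, fun b => i (b - 1), fun a => A (e a), ⟨by omega, ?_, ?_, fun a => hA _,
    fun a => ⟨(hmem a a).2 (Or.inl rfl), (hmem a (a + 1)).2 (Or.inr rfl)⟩⟩, hodd,
    fun a b => (hmem a b).1⟩
  · intro a b hab
    have hab : i (a - 1) = i (b - 1) := hab
    have h1 := (hmem a a).2 (Or.inl rfl)
    have h2 := (hmem b b).2 (Or.inl rfl)
    rw [hab, hmem] at h1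
    rw [← hab, hmem] at h2
    exact hswap a b h1 h2
  · intro a b hab
    have hab : A (e a) = A (e b) := hab
    have h1 := (hmem a a).2 (Or.inl rfl)
    have h2 := (hmem b b).2 (Or.inl rfl)
    rw [hab, hmem] at h1
    rw [← hab, hmem] at h2
    exact hswap a b h2 h1

/-- In a balanced hypergraph, for any rankings of the edges by the vertices there is a perfect
matching by edges and loops such that every edge has a vertex whose matching edge is ranked at
least as high. -/
theorem exists_stable_hypergraph_matching {I E : Type*} [Fintype I] [Finite E] [DecidableEq I]
    {edges : Finset I → Prop} (h : ¬ HasNontrivialOddCycle edges) {A : E → Finset I}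
    (hA : ∀ e, edges (A e)) (hne : ∀ e, (A e).Nonempty) (c : I → E → ℕ) :
    ∃ S : Set (I ⊕ E), (∀ i, ∃! j, j ∈ S ∧ loopInc A i j) ∧
      ∀ e, ∃ i ∈ A e, ∃ e', Sum.inr e' ∈ S ∧ i ∈ A e' ∧ c i e ≤ c i e' := by
  classical
  have := Fintype.ofFinite E
  rcases isEmpty_or_nonempty I with hI | hI
  · exact ⟨∅, fun i => hI.elim i, fun e => hI.elim (hne e).choose⟩
  obtain ⟨x, hx0, hsum, hdom⟩ := exists_stable_fractional A hne c
  obtain ⟨S, hSpos, hS⟩ := (isBalancedInc_loopInc h hA).exists_perfectMatching x hx0 hsum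
  refine ⟨S, hS, fun e => ?_⟩
  obtain ⟨i, hie, hxi, hi⟩ := hdom e
  obtain ⟨j, ⟨hjS, hj⟩, -⟩ := hS i
  rcases j with i' | e'
  · have hi' : i' = i := hj
    exact absurd (hi' ▸ hxi) (hSpos _ hjS).ne'
  · exact ⟨i, hie, e', hjS, hj, hi e' hj (hSpos _ hjS).ne'⟩

lemma DMarket.Ch_Ch {F W : Type*} [Fintype W] [DecidableEq F] [DecidableEq W]
    (M : DMarket F W) (f : F) (S : Finset W) : M.Ch f (M.Ch f S) = M.Ch f S := by
  by_contra hne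
  have := M.pf_sto f
  have h1 := M.Ch_max f (M.Ch f S) (M.Ch f S) subset_rfl (Ne.symm hne)
  have h2 := M.Ch_max f S _ ((M.Ch_subset f _).trans (M.Ch_subset f S)) hne
  exact irrefl_of (M.pf f) _ (trans_of (M.pf f) h1 h2)

/-- A stable matching exists in a discrete many-to-one matching market
if the firm-worker hypergraph has no nontrivial odd-length cycle. -/
theorem stmt1 {F W : Type*} [Fintype F] [Fintype W] [DecidableEq F] [DecidableEq W]
    (M : DMarket F W)
    (h : ¬ HasNontrivialOddCycle M.fwEdges) :
    ∃ μ : W → Option F, M.Stable μ := by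
  classical
  have htw : ∀ w {a b d}, M.pw w a b → M.pw w b d → M.pw w a d := fun w a b d h1 h2 =>
    have := M.pw_sto w
    trans_of (M.pw w) h1 h2
  have hiw : ∀ w a, ¬ M.pw w a a := fun w a =>
    have := M.pw_sto w
    irrefl_of (M.pw w) a
  have htf : ∀ f {a b d}, M.pf f a b → M.pf f b d → M.pf f a d := fun f a b d h1 h2 =>
    have := M.pf_sto f
    trans_of (M.pf f) h1 h2
  have hif : ∀ f a, ¬ M.pf f a a := fun f a =>
    have := M.pf_sto f
    irrefl_of (M.pf f) a
  let E := {p : F × Finset W // M.Satisf p.1 p.2 ∧ ∀ w ∈ p.2, M.pw w (some p.1) none}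
  let A : E → Finset (F ⊕ W) := fun e => insert (Sum.inl e.1.1) (e.1.2.image Sum.inr)
  have hAf : ∀ e f, Sum.inl f ∈ A e ↔ f = e.1.1 := fun e f => by simp [A]
  have hAw : ∀ e w, Sum.inr w ∈ A e ↔ w ∈ e.1.2 := fun e w => by simp [A]
  let worse : F ⊕ W → E → Finset (F × Finset W) := fun i e => i.elim
    (fun f => Finset.univ.filter fun p => M.pf f e.1.2 p.2)
    (fun w => Finset.univ.filter fun p => M.pw w (some e.1.1) (some p.1) ∨
      (p.1 = e.1.1 ∧ M.pf e.1.1 e.1.2 p.2))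
  have hcf : ∀ f (e e' : E), M.pf f e.1.2 e'.1.2 →
      (worse (Sum.inl f) e').card < (worse (Sum.inl f) e).card := by
    intro f e e' hee
    refine Finset.card_lt_card ((Finset.ssubset_iff_of_subset fun p hp => ?_).2 ⟨e'.1, ?_, ?_⟩)
    · simp only [worse, Sum.elim_inl, Finset.mem_filter, Finset.mem_univ, true_and] at hp ⊢
      exact htf f hee hp
    · simpa [worse] using hee
    · simpa [worse] using hif f _
  have hcw : ∀ w (e e' : E), (M.pw w (some e.1.1) (some e'.1.1) ∨
      (e'.1.1 = e.1.1 ∧ M.pf e.1.1 e.1.2 e'.1.2)) →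
      (worse (Sum.inr w) e').card < (worse (Sum.inr w) e).card := by
    intro w e e' hee
    refine Finset.card_lt_card ((Finset.ssubset_iff_of_subset fun p hp => ?_).2 ⟨e'.1, ?_, ?_⟩)
    · simp only [worse, Sum.elim_inr, Finset.mem_filter, Finset.mem_univ, true_and] at hp ⊢
      rcases hee with hee | ⟨hf, hee⟩
      · rcases hp with hp | ⟨hp, -⟩
        · exact Or.inl (htw w hee hp)
        · exact Or.inl (hp ▸ hee)
      · rw [hf] at hp
        exact hp.imp_right fun hp => ⟨hp.1, htf _ hee hp.2⟩
    · simpa [worse] using hee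
    · simp [worse, hiw, hif]
  obtain ⟨S, hS, hdom⟩ := exists_stable_hypergraph_matching h (A := A)
    (fun e => ⟨e.1.1, e.1.2, e.2.1, rfl⟩) (fun e => Finset.insert_nonempty _ _)
    (fun i e => (worse i e).card)
  choose m hm hmuniq using hS
  let μ : W → Option F := fun w => (m (Sum.inr w)).elim (fun _ => none) fun e => some e.1.1
  have hμ : ∀ {w f}, μ w = some f → ∃ e : E, m (Sum.inr w) = Sum.inr e ∧ e.1.1 = f := by
    intro w f hw
    rcases hmw : m (Sum.inr w) with i | e
    · simp [μ, hmw] at hw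
    · exact ⟨e, rfl, by simpa [μ, hmw] using hw⟩
  have hassigned : ∀ e : E, Sum.inr e ∈ S → assignedSet μ e.1.1 = e.1.2 := by
    intro e he
    ext w
    simp only [assignedSet, Finset.mem_filter, Finset.mem_univ, true_and]
    constructor
    · intro hw
      obtain ⟨e', he', hf⟩ := hμ hw
      have hm' := hm (Sum.inr w)
      rw [he'] at hm'
      have h1 := hmuniq (Sum.inl e.1.1) _ ⟨hm'.1, (hAf e' _).2 hf.symm⟩
      have h2 := hmuniq (Sum.inl e.1.1) _ ⟨he, (hAf e _).2 rfl⟩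
      obtain rfl := Sum.inr_injective (h1.trans h2.symm)
      exact (hAw e' w).1 hm'.2
    · intro hw
      have h1 := hmuniq (Sum.inr w) _ ⟨he, (hAw e w).2 hw⟩
      simp [μ, ← h1]
  have hacc : ∀ w, μ w = none ∨ M.pw w (μ w) none := by
    intro w
    rcases hw : μ w with _ | f
    · exact Or.inl rfl
    · obtain ⟨e, he, rfl⟩ := hμ hw
      have hm' := (hm (Sum.inr w)).2
      rw [he] at hm'
      exact Or.inr (e.2.2 w ((hAw e w).1 hm'))
  have hIR : ∀ f, M.Ch f (assignedSet μ f) = assignedSet μ f := by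
    intro f
    by_cases hemp : assignedSet μ f = ∅
    · rw [hemp]
      exact Finset.subset_empty.1 (M.Ch_subset f ∅)
    · obtain ⟨w, hw⟩ := Finset.nonempty_iff_ne_empty.2 hemp
      obtain ⟨e, he, rfl⟩ := hμ (Finset.mem_filter.1 hw).2
      have hm' := (hm (Sum.inr w)).1
      rw [he] at hm'
      rw [hassigned e hm']
      exact e.2.1.2
  refine ⟨μ, ⟨hacc, hIR⟩, ?_⟩
  rintro ⟨f, S', hpref, hS'⟩
  have hT : M.pf f (M.Ch f S') (assignedSet μ f) := by
    by_cases heq : S' = M.Ch f S'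
    · rwa [← heq]
    · exact htf f (M.Ch_max f S' S' subset_rfl heq) hS'
  have hTne : (M.Ch f S').Nonempty := by
    by_contra hemp
    rw [Finset.not_nonempty_iff_eq_empty] at hemp
    rw [hemp] at hT
    by_cases heq : ∅ = assignedSet μ f
    · exact hif f _ (heq ▸ hT)
    · have := M.Ch_max f (assignedSet μ f) ∅ (Finset.empty_subset _) (by rwa [hIR])
      rw [hIR] at this
      exact hif f _ (htf f hT this)
  have hprefT : ∀ w ∈ M.Ch f S', μ w = some f ∨ M.pw w (some f) (μ w) := fun w hw =>
    hpref w (M.Ch_subset f S' hw)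
  let e : E := ⟨(f, M.Ch f S'), ⟨hTne, M.Ch_Ch f S'⟩, fun w hw => by
    rcases hprefT w hw with h1 | h1
    · rw [← h1]
      exact (hacc w).resolve_left (by simp [h1])
    · rcases hacc w with h2 | h2
      · rwa [h2] at h1
      · exact htw w h1 h2⟩
  obtain ⟨i, hie, e', he'S, hie', hle⟩ := hdom e
  have hcase : e'.1.1 = f → M.pf f e.1.2 e'.1.2 := by
    rintro rfl
    rw [← hassigned e' he'S]
    exact hT
  rcases i with f' | w
  · obtain rfl : f' = f := (hAf e f').1 hie
    exact absurd hle (not_le.2 (hcf f' e e' (hcase ((hAf e' f').1 hie').symm)))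
  · refine absurd hle (not_le.2 (hcw w e e' ?_))
    have hμw : μ w = some e'.1.1 := by
      simp [μ, ← hmuniq (Sum.inr w) _ ⟨he'S, hie'⟩]
    rcases hprefT w ((hAw e w).1 hie) with h1 | h1
    · have hf : e'.1.1 = f := Option.some_injective _ (hμw.symm.trans h1)
      exact Or.inr ⟨hf, hcase hf⟩
    · exact Or.inl (hμw ▸ h1)
end
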